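/- arXiv:1909.10735 — 6 statements merged into one kernel-verified Lean document; each statement's English description precedes it below -/
import Mathlib

section
/- For every X in the Orlicz space L^Φ, the function m ↦ π_α(X,m) = m + N_α((X−m)^+) is convex on ℝ and satisfies lim_{m→−∞} π_α(X,m) = lim_{m→+∞} π_α(X,m) = ∞. Consequently the Haezendonck–Goovaerts premium principle π_α(X) = inf_{m∈ℝ} π_α(X,m) is finite and for every X ∈ L^Φ there exists m_X ∈ ℝ such that π_α(X) = π_α(X, m_X). -/
open MeasureTheory Filter Set Topology

/-- The Luxemburg norm associated with the Orlicz function `Θ`. -/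
noncomputable def luxNorm {Ω : Type*} [MeasurableSpace Ω] (μ : Measure Ω)
    (Θ : ℝ → ℝ) (X : Ω → ℝ) : ℝ :=
  sInf {l : ℝ | 0 < l ∧ ∫⁻ ω, ENNReal.ofReal (Θ (|X ω| / l)) ∂μ ≤ 1}

/-- Membership in the Orlicz space `L^Θ`. -/
def MemOrlicz {Ω : Type*} [MeasurableSpace Ω] (μ : Measure Ω)
    (Θ : ℝ → ℝ) (X : Ω → ℝ) : Prop :=
  Measurable X ∧ ∃ l : ℝ, 0 < l ∧ ∫⁻ ω, ENNReal.ofReal (Θ (|X ω| / l)) ∂μ < ⊤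

/-- The Haezendonck–Goovaerts premium principle at level `α`. -/
noncomputable def piHG {Ω : Type*} [MeasurableSpace Ω] (μ : Measure Ω)
    (Φ : ℝ → ℝ) (α : ℝ) (X : Ω → ℝ) : ℝ :=
  ⨅ m : ℝ, (m + luxNorm μ (fun x => Φ x / (1 - α)) (fun ω => max (X ω - m) 0))

theorem lux_meas {Ω : Type*} [MeasurableSpace Ω] (Θ : ℝ → ℝ)
    (hmono : MonotoneOn Θ (Ici 0)) (Y : Ω → ℝ) (hY : Measurable Y) (l : ℝ) (hl : 0 < l) :
    Measurable (fun ω => ENNReal.ofReal (Θ (|Y ω| / l))) := by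
  have h1 : Monotone (fun x : ℝ => Θ (max x 0)) := fun x y h =>
    hmono (mem_Ici.2 (le_max_right _ _)) (mem_Ici.2 (le_max_right _ _)) (max_le_max h le_rfl)
  have h2 : (fun ω => Θ (|Y ω| / l)) = fun ω => (fun x : ℝ => Θ (max x 0)) (|Y ω| / l) := by
    funext ω
    have : 0 ≤ |Y ω| / l := by positivity
    simp [max_eq_left this]
  apply ENNReal.measurable_ofReal.comp
  rw [h2]
  refine h1.measurable.comp ?_
  exact (hY.abs).div_const l

theorem lux_conv {Ω : Type*} [MeasurableSpace Ω] (μ : Measure Ω) (Θ : ℝ → ℝ)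
    (hmono : MonotoneOn Θ (Ici 0)) (hconv : ConvexOn ℝ (Ici 0) Θ) (hpos : ∀ x, 0 ≤ x → 0 ≤ Θ x)
    (X Y Z : Ω → ℝ) (hX : Measurable X) (hY : Measurable Y)
    (a b : ℝ) (ha : 0 ≤ a) (hb : 0 ≤ b) (hZ : ∀ ω, |Z ω| ≤ a * |X ω| + b * |Y ω|)
    (k l : ℝ) (hk : 0 < k) (hl : 0 < l) (hL : 0 < a * k + b * l)  :
    ∫⁻ ω, ENNReal.ofReal (Θ (|Z ω| / (a * k + b * l))) ∂μ ≤
      ENNReal.ofReal (a * k / (a * k + b * l)) * ∫⁻ ω, ENNReal.ofReal (Θ (|X ω| / k)) ∂μ +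
      ENNReal.ofReal (b * l / (a * k + b * l)) * ∫⁻ ω, ENNReal.ofReal (Θ (|Y ω| / l)) ∂μ := by
  set L := a * k + b * l with hLdef
  have hak : 0 ≤ a * k / L := by positivity
  have hbl : 0 ≤ b * l / L := by positivity
  have hmX := lux_meas Θ hmono X hX k hk
  have hmY := lux_meas Θ hmono Y hY l hl
  rw [← lintegral_const_mul _ hmX, ← lintegral_const_mul _ hmY,
    ← lintegral_add_left (hmX.const_mul _)]
  apply lintegral_mono
  intro ω
  have hx : 0 ≤ |X ω| / k := by positivity
  have hy : 0 ≤ |Y ω| / l := by positivity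
  have e : |Z ω| / L ≤ a * k / L * (|X ω| / k) + b * l / L * (|Y ω| / l) := by
    have : a * k / L * (|X ω| / k) + b * l / L * (|Y ω| / l) = (a * |X ω| + b * |Y ω|) / L := by
      field_simp
    rw [this]
    exact div_le_div_of_nonneg_right (hZ ω) hL.le
  have h1 : Θ (|Z ω| / L) ≤ a * k / L * Θ (|X ω| / k) + b * l / L * Θ (|Y ω| / l) := by
    refine (hmono (a := |Z ω| / L) ?_ ?_ e).trans ?_
    · exact mem_Ici.2 (by positivity)
    · exact mem_Ici.2 (by positivity)
    · have := hconv.2 (mem_Ici.2 hx) (mem_Ici.2 hy) hak hbl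
        (by rw [← add_div, ← hLdef]; exact div_self hL.ne')
      simpa using this
  have p1 := hpos _ hx
  have p2 := hpos _ hy
  simp only
  rw [← ENNReal.ofReal_mul hak, ← ENNReal.ofReal_mul hbl,
    ← ENNReal.ofReal_add (by positivity) (by positivity)]
  exact ENNReal.ofReal_le_ofReal h1

theorem lux_scale {Ω : Type*} [MeasurableSpace Ω] (μ : Measure Ω) (Θ : ℝ → ℝ)
    (hmono : MonotoneOn Θ (Ici 0)) (hconv : ConvexOn ℝ (Ici 0) Θ) (h0 : Θ 0 = 0)
    (hpos : ∀ x, 0 ≤ x → 0 ≤ Θ x)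
    (Y : Ω → ℝ) (hY : Measurable Y) (l : ℝ) (hl : 0 < l)
    (hfin : ∫⁻ ω, ENNReal.ofReal (Θ (|Y ω| / l)) ∂μ < ⊤) :
    ∃ k : ℝ, 0 < k ∧ ∫⁻ ω, ENNReal.ofReal (Θ (|Y ω| / k)) ∂μ ≤ 1 := by
  set I := ∫⁻ ω, ENNReal.ofReal (Θ (|Y ω| / l)) ∂μ with hI
  set r := I.toReal with hr
  have hr0 : 0 ≤ r := ENNReal.toReal_nonneg
  have hk : 0 < 1 * l + r * l := by positivity
  refine ⟨1 * l + r * l, hk, ?_⟩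
  have := lux_conv μ Θ hmono hconv hpos Y (fun _ => 0) Y hY measurable_const 1 r zero_le_one hr0
    (by intro ω; simp) l l hl hl hk
  refine this.trans ?_
  rw [← hI, ← ENNReal.ofReal_toReal hfin.ne, ← hr]
  simp only [abs_zero, zero_div, h0, ENNReal.ofReal_zero, lintegral_zero, mul_zero, add_zero]
  rw [← ENNReal.ofReal_mul (by positivity), ← ENNReal.ofReal_one]
  apply ENNReal.ofReal_le_ofReal
  rw [div_mul_eq_mul_div, div_le_one hk]
  nlinarith

theorem lux_main {Ω : Type*} [MeasurableSpace Ω] (μ : Measure Ω) [IsProbabilityMeasure μ]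
    (Θ : ℝ → ℝ) (h0 : Θ 0 = 0) (h1 : 1 < Θ 1)
    (hmono : MonotoneOn Θ (Ici 0)) (hconv : ConvexOn ℝ (Ici 0) Θ)
    (X : Ω → ℝ) (hX : MemOrlicz μ Θ X) :
    ConvexOn ℝ Set.univ
      (fun m : ℝ => m + luxNorm μ Θ (fun ω => max (X ω - m) 0)) ∧
    Tendsto (fun m : ℝ => m + luxNorm μ Θ (fun ω => max (X ω - m) 0)) atBot atTop ∧
    Tendsto (fun m : ℝ => m + luxNorm μ Θ (fun ω => max (X ω - m) 0)) atTop atTop := by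
  obtain ⟨hXm, l0, hl0, hfin⟩ := hX
  have hpos : ∀ x, 0 ≤ x → 0 ≤ Θ x := fun x hx => by
    have := hmono (mem_Ici.2 le_rfl) (mem_Ici.2 hx) hx
    rwa [h0] at this
  have hYm : ∀ m : ℝ, Measurable (fun ω => max (X ω - m) 0) := fun m =>
    (hXm.sub_const m).max measurable_const
  -- nonemptiness
  have hne : ∀ m : ℝ, {l : ℝ | 0 < l ∧
      ∫⁻ ω, ENNReal.ofReal (Θ (|max (X ω - m) 0| / l)) ∂μ ≤ 1}.Nonempty := by
    intro m
    have hL : 0 < 1 * l0 + 1 * l0 := by positivity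
    have := lux_conv μ Θ hmono hconv hpos X (fun _ => m) (fun ω => max (X ω - m) 0) hXm
      measurable_const 1 1 zero_le_one zero_le_one (by
        intro ω
        rw [abs_of_nonneg (le_max_right _ _), one_mul, one_mul]
        refine max_le ?_ (by positivity)
        linarith [le_abs_self (X ω), neg_abs_le m]) l0 l0 hl0 hl0 hL
    obtain ⟨k, hk, hkk⟩ := lux_scale μ Θ hmono hconv h0 hpos _ (hYm m) _ hL
      (lt_of_le_of_lt this (by
        simp only [lintegral_const, measure_univ, mul_one]
        exact ENNReal.add_lt_top.2 ⟨ENNReal.mul_lt_top ENNReal.ofReal_lt_top hfin,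
          ENNReal.mul_lt_top ENNReal.ofReal_lt_top ENNReal.ofReal_lt_top⟩))
    exact ⟨k, hk, hkk⟩
  have hbdd : ∀ m : ℝ, BddBelow {l : ℝ | 0 < l ∧
      ∫⁻ ω, ENNReal.ofReal (Θ (|max (X ω - m) 0| / l)) ∂μ ≤ 1} :=
    fun m => ⟨0, fun l hl => hl.1.le⟩
  have hnn : ∀ m : ℝ, 0 ≤ luxNorm μ Θ (fun ω => max (X ω - m) 0) := fun m =>
    Real.sInf_nonneg (fun l hl => hl.1.le)
  refine ⟨⟨convex_univ, ?_⟩, ?_, ?_⟩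
  · intro m _ n _ a b ha hb hab
    simp only [smul_eq_mul]
    suffices h : luxNorm μ Θ (fun ω => max (X ω - (a * m + b * n)) 0) ≤
        a * luxNorm μ Θ (fun ω => max (X ω - m) 0) + b * luxNorm μ Θ (fun ω => max (X ω - n) 0) by
      linarith
    apply le_of_forall_pos_le_add
    intro ε hε
    obtain ⟨k, ⟨hk, hk1⟩, hk2⟩ := exists_lt_of_csInf_lt (hne m) (lt_add_of_pos_right _ hε)
    obtain ⟨l, ⟨hl, hl1⟩, hl2⟩ := exists_lt_of_csInf_lt (hne n) (lt_add_of_pos_right _ hε)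
    change k < luxNorm μ Θ (fun ω => max (X ω - m) 0) + ε at hk2
    change l < luxNorm μ Θ (fun ω => max (X ω - n) 0) + ε at hl2
    have hL : 0 < a * k + b * l := by
      rcases ha.eq_or_lt with h | h
      · have : b = 1 := by linarith
        subst this; subst h; simpa using hl
      · positivity
    have key := lux_conv μ Θ hmono hconv hpos _ _ (fun ω => max (X ω - (a * m + b * n)) 0)
      (hYm m) (hYm n) a b ha hb (by
        intro ω
        simp only [abs_of_nonneg (le_max_right (_ : ℝ) 0)]
        refine max_le ?_ (by positivity)
        have e1 := mul_le_mul_of_nonneg_left (le_max_left (X ω - m) 0) ha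
        have e2 := mul_le_mul_of_nonneg_left (le_max_left (X ω - n) 0) hb
        have : X ω = a * X ω + b * X ω := by rw [← add_mul, hab, one_mul]
        linarith) k l hk hl hL
    have key2 : ∫⁻ ω, ENNReal.ofReal (Θ (|max (X ω - (a * m + b * n)) 0| / (a * k + b * l))) ∂μ
        ≤ 1 := by
      refine key.trans ((add_le_add (mul_le_mul_right hk1 _) (mul_le_mul_right hl1 _)).trans ?_)
      rw [mul_one, mul_one, ← ENNReal.ofReal_add (by positivity) (by positivity), ← add_div,
        div_self hL.ne', ENNReal.ofReal_one]
    have : luxNorm μ Θ (fun ω => max (X ω - (a * m + b * n)) 0) ≤ a * k + b * l :=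
      csInf_le (hbdd _) ⟨hL, key2⟩
    have e1 := mul_le_mul_of_nonneg_left hk2.le ha
    have e2 := mul_le_mul_of_nonneg_left hl2.le hb
    have : ε = a * ε + b * ε := by rw [← add_mul, hab, one_mul]
    linarith
  · -- choose s0
    have hcont : ContinuousAt Θ 1 := by
      have h := hconv.continuousOn_interior
      rw [interior_Ici] at h
      exact h.continuousAt (Ioi_mem_nhds one_pos)
    obtain ⟨s, hs0, hs1, hs⟩ : ∃ s : ℝ, 0 < s ∧ s < 1 ∧ 1 < Θ s := by
      have ev : ∀ᶠ s in 𝓝[<] (1:ℝ), 1 < Θ s :=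
        (hcont.eventually (lt_mem_nhds h1)).filter_mono nhdsWithin_le_nhds
      have ev2 : ∀ᶠ s in 𝓝[<] (1:ℝ), 0 < s :=
        (lt_mem_nhds (one_pos)).filter_mono nhdsWithin_le_nhds
      obtain ⟨s, ⟨hA, hB⟩, hC⟩ := ((ev.and ev2).and self_mem_nhdsWithin).exists
      exact ⟨s, hB, hC, hA⟩
    obtain ⟨k, hk⟩ : ∃ k : ℕ, 1 < ENNReal.ofReal (Θ s) * μ {ω | -(k:ℝ) ≤ X ω} := by
      have hU : (⋃ k : ℕ, {ω | -(k:ℝ) ≤ X ω}) = univ := by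
        ext ω
        obtain ⟨n, hn⟩ := exists_nat_ge (-X ω)
        simp only [mem_iUnion, mem_setOf_eq, mem_univ, iff_true]
        exact ⟨n, by linarith⟩
      have ht := tendsto_measure_iUnion_atTop (μ := μ) (s := fun k : ℕ => {ω | -(k:ℝ) ≤ X ω})
        (fun i j hij ω hω => by
          have : (i:ℝ) ≤ j := by exact_mod_cast hij
          simp only [mem_setOf_eq] at hω ⊢
          linarith)
      rw [hU, measure_univ] at ht
      have ht2 := ENNReal.Tendsto.const_mul (a := ENNReal.ofReal (Θ s)) ht (Or.inl one_ne_zero)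
      rw [mul_one] at ht2
      have : (1 : ENNReal) < ENNReal.ofReal (Θ s) := by
        rw [← ENNReal.ofReal_one]
        exact (ENNReal.ofReal_lt_ofReal_iff (by linarith)).2 hs
      exact (ht2.eventually (lt_mem_nhds this)).exists
    have lower : ∀ m : ℝ, (-k - m) / s ≤ luxNorm μ Θ (fun ω => max (X ω - m) 0) := by
      intro m
      refine le_csInf (hne m) ?_
      rintro l ⟨hl, hl1⟩
      by_contra hcon
      push Not at hcon
      rw [lt_div_iff₀ hs0] at hcon
      apply absurd hl1
      push Not
      refine lt_of_lt_of_le hk ?_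
      rw [← lintegral_indicator_const (measurableSet_le measurable_const hXm)]
      apply lintegral_mono
      intro ω
      by_cases hω : -(k:ℝ) ≤ X ω
      · rw [indicator_of_mem (by exact hω)]
        apply ENNReal.ofReal_le_ofReal
        have : s ≤ |max (X ω - m) 0| / l := by
          rw [le_div_iff₀ hl, abs_of_nonneg (le_max_right _ _)]
          refine le_trans ?_ (le_max_left _ _)
          linarith
        exact hmono (mem_Ici.2 hs0.le) (mem_Ici.2 (hs0.le.trans this)) this
      · rw [indicator_of_notMem (by exact hω)]
        exact zero_le
    have hc : 0 < 1 / s - 1 := by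
      rw [sub_pos, lt_div_iff₀ hs0]; linarith
    have T : Tendsto (fun m : ℝ => (1 / s - 1) * (-m) + (-(k:ℝ) / s)) atBot atTop :=
      tendsto_atTop_add_const_right _ _ (tendsto_neg_atBot_atTop.const_mul_atTop hc)
    refine tendsto_atTop_mono (fun m => ?_) T
    have e : (1 / s - 1) * (-m) + (-(k:ℝ) / s) = m + (-k - m) / s := by ring
    rw [e]
    linarith [lower m]
  · exact tendsto_atTop_mono (fun m => le_add_of_nonneg_right (hnn m)) tendsto_id

/-- For every `X ∈ L^Φ`, the map `m ↦ π_α(X, m) = m + N_α((X - m)⁺)` is convex on `ℝ`,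
tends to `∞` as `m → ±∞`, and the Haezendonck–Goovaerts premium principle
`π_α(X) = inf_m π_α(X, m)` is finite (the infimum is bounded below) and is attained at
some `m_X ∈ ℝ`. -/
theorem stmt_0 {Ω : Type*} [MeasurableSpace Ω] (μ : Measure Ω) [IsProbabilityMeasure μ]
    (hNA : ∀ A : Set Ω, MeasurableSet A → 0 < μ A →
      ∃ B : Set Ω, B ⊆ A ∧ MeasurableSet B ∧ 0 < μ B ∧ μ B < μ A)
    (Φ : ℝ → ℝ) (hΦ0 : Φ 0 = 0) (hΦ1 : Φ 1 = 1)
    (hΦmono : MonotoneOn Φ (Ici 0)) (hΦconv : ConvexOn ℝ (Ici 0) Φ)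
    (α : ℝ) (hα : α ∈ Ioo (0 : ℝ) 1)
    (X : Ω → ℝ) (hX : MemOrlicz μ Φ X) :
    ConvexOn ℝ Set.univ
      (fun m : ℝ => m + luxNorm μ (fun x => Φ x / (1 - α)) (fun ω => max (X ω - m) 0)) ∧
    Tendsto (fun m : ℝ => m + luxNorm μ (fun x => Φ x / (1 - α)) (fun ω => max (X ω - m) 0))
      atBot atTop ∧
    Tendsto (fun m : ℝ => m + luxNorm μ (fun x => Φ x / (1 - α)) (fun ω => max (X ω - m) 0))
      atTop atTop ∧
    BddBelow (Set.range
      (fun m : ℝ => m + luxNorm μ (fun x => Φ x / (1 - α)) (fun ω => max (X ω - m) 0))) ∧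
    ∃ mX : ℝ, piHG μ Φ α X
      = mX + luxNorm μ (fun x => Φ x / (1 - α)) (fun ω => max (X ω - mX) 0) := by
  have hα1 : 0 < 1 - α := by linarith [hα.2]
  have key := lux_main μ (fun x => Φ x / (1 - α)) (by simp [hΦ0])
    (by simp only [hΦ1]; rw [lt_div_iff₀ hα1]; linarith [hα.1])
    (fun x hx y hy h => div_le_div_of_nonneg_right (hΦmono hx hy h) hα1.le)
    (by
      have := hΦconv.smul (c := (1 - α)⁻¹) (by positivity)
      refine this.congr ?_
      intro x _
      simp [div_eq_inv_mul])
    X (by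
      obtain ⟨h1, l, hl, h2⟩ := hX
      refine ⟨h1, l, hl, ?_⟩
      have e : ∀ x : ℝ, ENNReal.ofReal (Φ x / (1 - α)) =
          ENNReal.ofReal (1 - α)⁻¹ * ENNReal.ofReal (Φ x) := fun x => by
        rw [div_eq_inv_mul, ENNReal.ofReal_mul (by positivity)]
      simp only [e]
      rw [lintegral_const_mul _ (lux_meas Φ hΦmono X h1 l hl)]
      exact ENNReal.mul_lt_top ENNReal.ofReal_lt_top h2)
  obtain ⟨hc, hbot, htop⟩ := key
  have hcont := continuousOn_univ.1 (hc.continuousOn isOpen_univ)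
  obtain ⟨mX, hmX⟩ := hcont.exists_forall_le (by
    rw [cocompact_eq_atBot_atTop]; exact hbot.sup htop)
  have hb : BddBelow (Set.range
      (fun m : ℝ => m + luxNorm μ (fun x => Φ x / (1 - α)) (fun ω => max (X ω - m) 0))) :=
    ⟨_, by rintro _ ⟨m, rfl⟩; exact hmX m⟩
  refine ⟨hc, hbot, htop, hb, mX, ?_⟩
  exact le_antisymm (ciInf_le hb mX) (le_ciInf hmX)
end

section
/- The Haezendonck–Goovaerts premium principle π_α : L^Φ → ℝ is sublinear (π_α(λX) = λπ_α(X) for all λ ≥ 0 and π_α(X+Y) ≤ π_α(X)+π_α(Y)), monotone increasing (X ≤ Y a.s. implies π_α(X) ≤ π_α(Y)), translation invariant (π_α(X+c) = π_α(X)+c for every constant c ∈ ℝ), and law invariant (if X and Y have the same distribution then π_α(X) = π_α(Y)). -/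
open MeasureTheory Filter Set Topology

/-- The set of admissible scalings. -/
def luxSet {Ω : Type*} [MeasurableSpace Ω] (μ : Measure Ω)
    (Θ : ℝ → ℝ) (X : Ω → ℝ) : Set ℝ :=
  {l : ℝ | 0 < l ∧ ∫⁻ ω, ENNReal.ofReal (Θ (|X ω| / l)) ∂μ ≤ 1}

lemma luxNorm_eq {Ω : Type*} [MeasurableSpace Ω] (μ : Measure Ω)
    (Θ : ℝ → ℝ) (X : Ω → ℝ) : luxNorm μ Θ X = sInf (luxSet μ Θ X) := rfl

lemma luxSet_bdd {Ω : Type*} [MeasurableSpace Ω] (μ : Measure Ω)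
    (Θ : ℝ → ℝ) (X : Ω → ℝ) : BddBelow (luxSet μ Θ X) :=
  ⟨0, fun _ h => h.1.le⟩

lemma luxNorm_nonneg {Ω : Type*} [MeasurableSpace Ω] (μ : Measure Ω)
    (Θ : ℝ → ℝ) (X : Ω → ℝ) : 0 ≤ luxNorm μ Θ X :=
  Real.sInf_nonneg fun _ h => h.1.le

/-- Properties of the scaled Orlicz function. -/
structure Good (Θ : ℝ → ℝ) : Prop where
  zero : Θ 0 = 0
  one : 1 < Θ 1
  mono : MonotoneOn Θ (Ici 0)
  conv : ConvexOn ℝ (Ici 0) Θ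

section
variable {Ω : Type*} [MeasurableSpace Ω] {μ : Measure Ω} {Θ : ℝ → ℝ}

lemma Good.meas (h : Good Θ) : ∃ f : ℝ → ENNReal, Measurable f ∧
    ∀ x, 0 ≤ x → ENNReal.ofReal (Θ x) = f x := by
  refine ⟨fun x => ENNReal.ofReal (Θ (max x 0)), ?_, fun x hx => by simp [hx]⟩
  have : Monotone fun x => Θ (max x 0) := fun x y hxy =>
    h.mono (by simp) (by simp) (max_le_max hxy le_rfl)
  exact this.measurable.ennreal_ofReal

lemma Good.measX (h : Good Θ) {X : Ω → ℝ} (hX : Measurable X) {l : ℝ} (hl : 0 < l) :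
    Measurable fun ω => ENNReal.ofReal (Θ (|X ω| / l)) := by
  obtain ⟨f, hf, hfe⟩ := h.meas
  have : (fun ω => ENNReal.ofReal (Θ (|X ω| / l))) = fun ω => f (|X ω| / l) :=
    funext fun ω => hfe _ (by positivity)
  rw [this]
  exact hf.comp ((continuous_abs.measurable.comp hX).div_const l)

lemma Good.nonneg (h : Good Θ) {x : ℝ} (hx : 0 ≤ x) : 0 ≤ Θ x := by
  rw [← h.zero]; exact h.mono (by simp) hx hx

lemma luxSet_mono (h : Good Θ) {X Z : Ω → ℝ} (hZ : ∀ᵐ ω ∂μ, |Z ω| ≤ |X ω|) :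
    luxSet μ Θ X ⊆ luxSet μ Θ Z := by
  rintro l ⟨hl, hi⟩
  refine ⟨hl, le_trans (lintegral_mono_ae ?_) hi⟩
  filter_upwards [hZ] with ω hω
  apply ENNReal.ofReal_le_ofReal
  have h1 : 0 ≤ |Z ω| / l := by positivity
  have h2 : 0 ≤ |X ω| / l := by positivity
  exact h.mono h1 h2 (by gcongr)

lemma luxSet_add (h : Good Θ) {X Y Z : Ω → ℝ} (hX : Measurable X) {a b : ℝ}
    (ha : a ∈ luxSet μ Θ X) (hb : b ∈ luxSet μ Θ Y)
    (hZ : ∀ᵐ ω ∂μ, |Z ω| ≤ |X ω| + |Y ω|) : a + b ∈ luxSet μ Θ Z := by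
  obtain ⟨ha, hai⟩ := ha
  obtain ⟨hb, hbi⟩ := hb
  have hab : 0 < a + b := by positivity
  refine ⟨hab, ?_⟩
  have hp : a / (a + b) + b / (a + b) = 1 := by field_simp
  calc ∫⁻ ω, ENNReal.ofReal (Θ (|Z ω| / (a + b))) ∂μ
      ≤ ∫⁻ ω, (ENNReal.ofReal (a / (a + b)) * ENNReal.ofReal (Θ (|X ω| / a))
          + ENNReal.ofReal (b / (a + b)) * ENNReal.ofReal (Θ (|Y ω| / b))) ∂μ := by
        apply lintegral_mono_ae
        filter_upwards [hZ] with ω hω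
        have h1 : 0 ≤ |Z ω| / (a + b) := by positivity
        have hx : 0 ≤ |X ω| / a := by positivity
        have hy : 0 ≤ |Y ω| / b := by positivity
        have hc := h.conv.2 hx hy (show 0 ≤ a / (a + b) by positivity)
          (show 0 ≤ b / (a + b) by positivity) hp
        simp only [smul_eq_mul] at hc
        have e : a / (a + b) * (|X ω| / a) + b / (a + b) * (|Y ω| / b)
            = (|X ω| + |Y ω|) / (a + b) := by field_simp
        rw [e] at hc
        have hs : 0 ≤ (|X ω| + |Y ω|) / (a + b) := by positivity
        have hm := h.mono h1 hs (by gcongr)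
        rw [← ENNReal.ofReal_mul (by positivity), ← ENNReal.ofReal_mul (by positivity),
          ← ENNReal.ofReal_add (mul_nonneg (by positivity) (h.nonneg hx))
            (mul_nonneg (by positivity) (h.nonneg hy))]
        exact ENNReal.ofReal_le_ofReal (hm.trans hc)
    _ = ENNReal.ofReal (a / (a + b)) * ∫⁻ ω, ENNReal.ofReal (Θ (|X ω| / a)) ∂μ
          + ENNReal.ofReal (b / (a + b)) * ∫⁻ ω, ENNReal.ofReal (Θ (|Y ω| / b)) ∂μ := by
        rw [lintegral_add_left ((h.measX hX ha).const_mul _),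
          lintegral_const_mul' _ _ ENNReal.ofReal_ne_top,
          lintegral_const_mul' _ _ ENNReal.ofReal_ne_top]
    _ ≤ ENNReal.ofReal (a / (a + b)) * 1 + ENNReal.ofReal (b / (a + b)) * 1 := by gcongr
    _ = 1 := by
        rw [mul_one, mul_one, ← ENNReal.ofReal_add (by positivity) (by positivity), hp,
          ENNReal.ofReal_one]

lemma luxNorm_add (h : Good Θ) {X Y Z : Ω → ℝ} (hX : Measurable X)
    (hXn : (luxSet μ Θ X).Nonempty) (hYn : (luxSet μ Θ Y).Nonempty)
    (hZ : ∀ᵐ ω ∂μ, |Z ω| ≤ |X ω| + |Y ω|) :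
    luxNorm μ Θ Z ≤ luxNorm μ Θ X + luxNorm μ Θ Y := by
  rw [← sub_le_iff_le_add]
  refine le_csInf hXn fun a ha => ?_
  rw [sub_le_comm]
  refine le_csInf hYn fun b hb => ?_
  rw [sub_le_iff_le_add']
  exact csInf_le (luxSet_bdd _ _ _) (luxSet_add h hX ha hb hZ)

lemma luxSet_nonempty (h : Good Θ) {X : Ω → ℝ}
    (hX : ∃ l : ℝ, 0 < l ∧ ∫⁻ ω, ENNReal.ofReal (Θ (|X ω| / l)) ∂μ < ⊤) :
    (luxSet μ Θ X).Nonempty := by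
  obtain ⟨l, hl, hi⟩ := hX
  set I := ∫⁻ ω, ENNReal.ofReal (Θ (|X ω| / l)) ∂μ with hI
  set t : ℝ := I.toReal + 1 with ht
  have ht1 : 1 ≤ t := by simp [ht]
  have ht0 : 0 < t := by linarith
  refine ⟨l * t, by positivity, ?_⟩
  calc ∫⁻ ω, ENNReal.ofReal (Θ (|X ω| / (l * t))) ∂μ
      ≤ ∫⁻ ω, ENNReal.ofReal (1 / t) * ENNReal.ofReal (Θ (|X ω| / l)) ∂μ := by
        apply lintegral_mono
        intro ω
        have hx : 0 ≤ |X ω| / l := by positivity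
        have hc := h.conv.2 hx (show (0 : ℝ) ∈ Ici (0 : ℝ) by simp)
          (show 0 ≤ 1 / t by positivity)
          (show 0 ≤ 1 - 1 / t by rw [sub_nonneg, div_le_one ht0]; exact ht1) (by ring)
        simp only [smul_eq_mul, mul_zero, add_zero, h.zero] at hc
        dsimp only
        rw [← ENNReal.ofReal_mul (by positivity)]
        apply ENNReal.ofReal_le_ofReal
        have e : |X ω| / (l * t) = 1 / t * (|X ω| / l) := by field_simp
        rw [e]
        exact hc
    _ = ENNReal.ofReal (1 / t) * I := by
        rw [lintegral_const_mul' _ _ ENNReal.ofReal_ne_top]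
    _ ≤ 1 := by
        rw [← ENNReal.ofReal_toReal hi.ne, ← ENNReal.ofReal_mul (by positivity),
          ENNReal.ofReal_le_one, div_mul_eq_mul_div, one_mul, div_le_one ht0]
        simp [ht]

lemma luxSet_const_nonempty [IsProbabilityMeasure μ] (h : Good Θ) (c : ℝ) :
    (luxSet μ Θ (fun _ => c)).Nonempty :=
  luxSet_nonempty h ⟨1, one_pos, by simp⟩

lemma luxSet_part_nonempty [IsProbabilityMeasure μ] (h : Good Θ) {X : Ω → ℝ} (hX : Measurable X)
    (hn : (luxSet μ Θ X).Nonempty) (m : ℝ) :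
    (luxSet μ Θ (fun ω => max (X ω - m) 0)).Nonempty := by
  obtain ⟨a, ha⟩ := hn
  obtain ⟨b, hb⟩ := luxSet_const_nonempty (μ := μ) h m
  refine ⟨a + b, luxSet_add h hX ha hb (ae_of_all _ fun ω => ?_)⟩
  rw [abs_of_nonneg (le_max_right _ _)]
  apply max_le
  · have := le_abs_self (X ω); have := neg_abs_le m; linarith
  · positivity

lemma lower [IsProbabilityMeasure μ] (h : Good Θ) {X : Ω → ℝ} (hX : Measurable X)
    {b : ℝ} (hb : b ∈ luxSet μ Θ X) (m : ℝ) :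
    -b ≤ m + luxNorm μ Θ (fun ω => max (X ω - m) 0) := by
  rw [← sub_le_iff_le_add']
  refine le_csInf (luxSet_part_nonempty h hX ⟨b, hb⟩ m) fun a ha => ?_
  have ha0 : 0 < a := ha.1
  have hb0 : 0 < b := hb.1
  have hs : b + a ∈ luxSet μ Θ (fun _ => m) ∨ 0 ≤ m := by
    rcases le_total 0 m with hm | hm
    · exact Or.inr hm
    · refine Or.inl (luxSet_add h hX hb ha (ae_of_all _ fun ω => ?_))
      rw [abs_of_nonneg (le_max_right (X ω - m) 0), abs_of_nonpos hm]
      have := neg_abs_le (X ω); have := le_abs_self (X ω)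
      have := le_max_left (X ω - m) 0
      linarith
  rcases hs with ⟨h0, hs⟩ | hm
  · simp only [lintegral_const, measure_univ, mul_one, ENNReal.ofReal_le_one] at hs
    by_contra! hcon
    have h1 : 1 ≤ |m| / (b + a) := by
      rw [one_le_div h0]
      have := neg_abs_le m
      linarith
    have := h.mono (a := 1) (b := |m| / (b + a)) (by simp) (zero_le_one.trans h1) h1
    linarith [h.one]
  · linarith

lemma piBdd [IsProbabilityMeasure μ] (h : Good Θ) {X : Ω → ℝ} (hX : Measurable X)
    (hn : (luxSet μ Θ X).Nonempty) :
    BddBelow (range fun m : ℝ => m + luxNorm μ Θ (fun ω => max (X ω - m) 0)) := by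
  obtain ⟨b, hb⟩ := hn
  refine ⟨-b, ?_⟩
  rintro _ ⟨m, rfl⟩
  exact lower h hX hb m

lemma luxNorm_smul_le {X : Ω → ℝ} {c : ℝ} (hc : 0 < c) (hn : (luxSet μ Θ X).Nonempty) :
    luxNorm μ Θ (fun ω => c * X ω) ≤ c * luxNorm μ Θ X := by
  rw [← div_le_iff₀' hc]
  refine le_csInf hn fun a ha => ?_
  rw [div_le_iff₀' hc]
  refine csInf_le (luxSet_bdd _ _ _) ⟨mul_pos hc ha.1, ?_⟩
  have : ∀ ω, |c * X ω| / (c * a) = |X ω| / a := fun ω => by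
    rw [abs_mul, abs_of_pos hc, mul_div_mul_left _ _ hc.ne']
  simp only [this]
  exact ha.2

lemma luxSet_smul_nonempty {X : Ω → ℝ} {c : ℝ} (hc : 0 < c) (hn : (luxSet μ Θ X).Nonempty) :
    (luxSet μ Θ (fun ω => c * X ω)).Nonempty := by
  obtain ⟨a, ha⟩ := hn
  refine ⟨c * a, mul_pos hc ha.1, ?_⟩
  have : ∀ ω, |c * X ω| / (c * a) = |X ω| / a := fun ω => by
    rw [abs_mul, abs_of_pos hc, mul_div_mul_left _ _ hc.ne']
  simp only [this]
  exact ha.2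

lemma luxNorm_smul {X : Ω → ℝ} {c : ℝ} (hc : 0 < c) (hn : (luxSet μ Θ X).Nonempty) :
    luxNorm μ Θ (fun ω => c * X ω) = c * luxNorm μ Θ X := by
  refine le_antisymm (luxNorm_smul_le hc hn) ?_
  have := luxNorm_smul_le (inv_pos.2 hc) (luxSet_smul_nonempty hc hn)
  simp only [inv_mul_cancel_left₀ hc.ne'] at this
  rwa [le_inv_mul_iff₀ hc] at this

lemma luxSet_map (h : Good Θ) {X Y : Ω → ℝ} (hX : Measurable X) (hY : Measurable Y)
    (hXY : μ.map X = μ.map Y) (m : ℝ) :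
    luxNorm μ Θ (fun ω => max (X ω - m) 0) = luxNorm μ Θ (fun ω => max (Y ω - m) 0) := by
  have key : ∀ l : ℝ, 0 < l → ∫⁻ ω, ENNReal.ofReal (Θ (|max (X ω - m) 0| / l)) ∂μ
      = ∫⁻ ω, ENNReal.ofReal (Θ (|max (Y ω - m) 0| / l)) ∂μ := by
    intro l hl
    have hg : Measurable fun x : ℝ => ENNReal.ofReal (Θ (|max (x - m) 0| / l)) :=
      h.measX ((measurable_id.sub_const m).max measurable_const) hl
    rw [← lintegral_map hg hX, ← lintegral_map hg hY, hXY]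
  unfold luxNorm
  congr 1
  ext l
  simp only [mem_ofPred_eq]
  exact and_congr_right fun hl => by rw [key l hl]

end

/-- The Haezendonck–Goovaerts premium principle `π_α` is positively homogeneous,
subadditive, monotone increasing, translation invariant, and law invariant on `L^Φ`. -/
theorem stmt_1 {Ω : Type*} [MeasurableSpace Ω] (μ : Measure Ω) [IsProbabilityMeasure μ]
    (hNA : ∀ A : Set Ω, MeasurableSet A → 0 < μ A →
      ∃ B : Set Ω, B ⊆ A ∧ MeasurableSet B ∧ 0 < μ B ∧ μ B < μ A)
    (Φ : ℝ → ℝ) (hΦ0 : Φ 0 = 0) (hΦ1 : Φ 1 = 1)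
    (hΦmono : MonotoneOn Φ (Ici 0)) (hΦconv : ConvexOn ℝ (Ici 0) Φ)
    (α : ℝ) (hα : α ∈ Ioo (0 : ℝ) 1) :
    -- positive homogeneity
    (∀ X : Ω → ℝ, MemOrlicz μ Φ X → ∀ c : ℝ, 0 ≤ c →
      piHG μ Φ α (fun ω => c * X ω) = c * piHG μ Φ α X) ∧
    -- subadditivity
    (∀ X Y : Ω → ℝ, MemOrlicz μ Φ X → MemOrlicz μ Φ Y →
      piHG μ Φ α (fun ω => X ω + Y ω) ≤ piHG μ Φ α X + piHG μ Φ α Y) ∧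
    -- monotonicity
    (∀ X Y : Ω → ℝ, MemOrlicz μ Φ X → MemOrlicz μ Φ Y → (∀ᵐ ω ∂μ, X ω ≤ Y ω) →
      piHG μ Φ α X ≤ piHG μ Φ α Y) ∧
    -- translation invariance
    (∀ X : Ω → ℝ, MemOrlicz μ Φ X → ∀ c : ℝ,
      piHG μ Φ α (fun ω => X ω + c) = piHG μ Φ α X + c) ∧
    -- law invariance
    (∀ X Y : Ω → ℝ, MemOrlicz μ Φ X → MemOrlicz μ Φ Y →
      μ.map X = μ.map Y → piHG μ Φ α X = piHG μ Φ α Y) := by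
  have h1a : 0 < 1 - α := by linarith [hα.2]
  have hG : Good (fun x => Φ x / (1 - α)) := by
    refine ⟨by simp [hΦ0], ?_, ?_, ?_⟩
    · rw [hΦ1]
      rw [lt_div_iff₀ h1a]
      linarith [hα.1]
    · intro x hx y hy hxy
      have := hΦmono hx hy hxy
      dsimp only
      gcongr
    · have := hΦconv.smul (inv_nonneg.2 h1a.le)
      have e : (fun x => Φ x / (1 - α)) = fun x => (1 - α)⁻¹ • Φ x := by
        funext x
        rw [smul_eq_mul, div_eq_inv_mul]
      rw [e]
      exact this
  have hne : ∀ X : Ω → ℝ, MemOrlicz μ Φ X →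
      (luxSet μ (fun x => Φ x / (1 - α)) X).Nonempty := by
    rintro X ⟨-, l, hl, hi⟩
    refine luxSet_nonempty hG ⟨l, hl, ?_⟩
    have : ∀ ω, ENNReal.ofReal (Φ (|X ω| / l) / (1 - α))
        = ENNReal.ofReal ((1 - α)⁻¹) * ENNReal.ofReal (Φ (|X ω| / l)) := fun ω => by
      rw [← ENNReal.ofReal_mul (by positivity), div_eq_inv_mul]
    simp only [this]
    rw [lintegral_const_mul' _ _ ENNReal.ofReal_ne_top]
    exact ENNReal.mul_lt_top ENNReal.ofReal_lt_top hi
  unfold piHG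
  generalize (fun x => Φ x / (1 - α)) = Θ at hG hne ⊢
  refine ⟨?_, ?_, ?_, ?_, ?_⟩
  · intro X hX c hc
    rcases hc.eq_or_lt with rfl | hc
    · simp only [zero_mul]
      have h0 : ∀ b : ℝ, 0 < b → b ∈ luxSet μ Θ (fun _ : Ω => (0 : ℝ)) := fun b hb =>
        ⟨hb, by simp [hG.zero]⟩
      have hb := piBdd hG (measurable_const (a := (0 : ℝ))) ⟨1, h0 1 one_pos⟩
      apply le_antisymm
      · refine (ciInf_le hb 0).trans ?_
        simp only [sub_zero, max_self, zero_add]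
        refine le_of_forall_pos_le_add fun b hb => ?_
        rw [zero_add]
        exact csInf_le (luxSet_bdd _ _ _) (h0 b hb)
      · refine le_ciInf fun m => le_of_forall_pos_le_add fun b hb => ?_
        have := lower hG measurable_const (h0 b hb) m
        linarith
    · rw [Real.mul_iInf_of_nonneg hc.le]
      rw [← (Equiv.mulLeft₀ c hc.ne').surjective.iInf_comp]
      congr 1
      funext m
      rw [mul_add, ← luxNorm_smul hc (luxSet_part_nonempty hG hX.1 (hne X hX) m)]
      simp only [Equiv.mulLeft₀_apply, mul_max_of_nonneg _ _ hc.le, mul_sub, mul_zero]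
  · intro X Y hX hY
    have hs : (luxSet μ Θ (fun ω => X ω + Y ω)).Nonempty := by
      obtain ⟨a, ha⟩ := hne X hX
      obtain ⟨b, hb⟩ := hne Y hY
      exact ⟨a + b, luxSet_add hG hX.1 ha hb (ae_of_all _ fun ω => abs_add_le _ _)⟩
    refine le_ciInf_add_ciInf fun m n => ?_
    refine (ciInf_le (piBdd hG (hX.1.add hY.1 : Measurable fun ω => X ω + Y ω) hs) (m + n)).trans ?_
    have := luxNorm_add (μ := μ) (Z := fun ω => max (X ω + Y ω - (m + n)) 0) hG
      ((hX.1.sub_const m).max measurable_const)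
      (luxSet_part_nonempty hG hX.1 (hne X hX) m) (luxSet_part_nonempty hG hY.1 (hne Y hY) n)
      (ae_of_all _ fun ω => by
        simp only [abs_of_nonneg (le_max_right _ (0 : ℝ))]
        apply max_le
        · linarith [le_max_left (X ω - m) 0, le_max_left (Y ω - n) 0]
        · positivity)
    simp only [Pi.add_apply]
    linarith
  · intro X Y hX hY hXY
    refine ciInf_mono (piBdd hG hX.1 (hne X hX)) fun m => ?_
    gcongr
    refine csInf_le_csInf (luxSet_bdd _ _ _) (luxSet_part_nonempty hG hY.1 (hne Y hY) m)
      (luxSet_mono hG ?_)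
    filter_upwards [hXY] with ω hω
    simp only [abs_of_nonneg (le_max_right _ (0 : ℝ))]
    gcongr
  · intro X hX c
    rw [ciInf_add (piBdd hG hX.1 (hne X hX)), ← (Equiv.addRight c).surjective.iInf_comp]
    congr 1
    funext m
    simp only [Equiv.coe_addRight, add_sub_add_right_eq_sub]
    ring
  · intro X Y hX hY hXY
    congr 1
    funext m
    rw [luxSet_map hG hX.1 hY.1 hXY m]
end

section
/- The Haezendonck–Goovaerts premium principle π_α is continuous from below: for every sequence (X_n) ⊂ L^Φ and every X ∈ L^Φ, if (X_n) is nondecreasing and X_n → X almost surely, then π_α(X_n) → π_α(X). -/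
open MeasureTheory Filter Set Topology

section aux
variable {Ω : Type*} [MeasurableSpace Ω] {μ : Measure Ω}

/-- admissible set -/
def admS (μ : Measure Ω) (Θ : ℝ → ℝ) (Y : Ω → ℝ) : Set ℝ :=
  {l : ℝ | 0 < l ∧ ∫⁻ ω, ENNReal.ofReal (Θ (|Y ω| / l)) ∂μ ≤ 1}

lemma lux_le_aux {Θ : ℝ → ℝ} {Y : Ω → ℝ} {l : ℝ} (h : l ∈ admS μ Θ Y) : luxNorm μ Θ Y ≤ l :=
  csInf_le ⟨0, fun _ hx => hx.1.le⟩ h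

lemma lux_nonneg_aux (Θ : ℝ → ℝ) (Y : Ω → ℝ) : 0 ≤ luxNorm μ Θ Y :=
  Real.sInf_nonneg fun _ hx => hx.1.le

lemma admS_mono {Θ : ℝ → ℝ} (hm : MonotoneOn Θ (Ici 0)) {Y Z : Ω → ℝ}
    (h : ∀ᵐ ω ∂μ, |Y ω| ≤ |Z ω|) {l l' : ℝ} (hl : l ∈ admS μ Θ Z) (hll : l ≤ l') :
    l' ∈ admS μ Θ Y := by
  have h0 := hl.1
  refine ⟨h0.trans_le hll, le_trans (lintegral_mono_ae ?_) hl.2⟩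
  filter_upwards [h] with ω hω
  apply ENNReal.ofReal_le_ofReal
  apply hm
  · exact div_nonneg (abs_nonneg _) (h0.trans_le hll).le
  · exact div_nonneg (abs_nonneg _) h0.le
  · exact div_le_div₀ (abs_nonneg _) hω h0 hll

lemma admS_of_lt {Θ : ℝ → ℝ} (hm : MonotoneOn Θ (Ici 0)) {Y : Ω → ℝ}
    (hne : (admS μ Θ Y).Nonempty) {l : ℝ} (h : luxNorm μ Θ Y < l) : l ∈ admS μ Θ Y := by
  obtain ⟨a, ha, hal⟩ := exists_lt_of_csInf_lt hne h
  exact admS_mono hm (Eventually.of_forall fun _ => le_rfl) ha hal.le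

lemma cont_aux {Φ : ℝ → ℝ} (hΦ0 : Φ 0 = 0) (hΦ1 : Φ 1 = 1)
    (hΦmono : MonotoneOn Φ (Ici 0)) (hΦconv : ConvexOn ℝ (Ici 0) Φ) :
    ContinuousOn Φ (Ici 0) := by
  have hi : ContinuousOn Φ (Ioi 0) := by
    have := hΦconv.continuousOn_interior
    rwa [interior_Ici] at this
  intro x hx
  rcases eq_or_lt_of_le (show (0:ℝ) ≤ x from hx) with h | h
  · subst h
    have hle : ∀ᶠ y in 𝓝[Ici 0] (0:ℝ), Φ y ≤ y := by
      have h1 : ∀ᶠ y in 𝓝[Ici 0] (0:ℝ), y < 1 :=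
        nhdsWithin_le_nhds (Iio_mem_nhds one_pos)
      filter_upwards [h1, self_mem_nhdsWithin] with y hy hy0
      have := hΦconv.2 (show (0:ℝ) ∈ Ici 0 by simp) (show (1:ℝ) ∈ Ici 0 by simp)
        (show 0 ≤ 1 - y by linarith) hy0 (by ring)
      simpa [hΦ0, hΦ1] using this
    have hge : ∀ᶠ y in 𝓝[Ici 0] (0:ℝ), 0 ≤ Φ y := by
      filter_upwards [self_mem_nhdsWithin] with y hy0
      rw [← hΦ0]; exact hΦmono (by simp) hy0 hy0
    unfold ContinuousWithinAt
    rw [hΦ0]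
    exact tendsto_of_tendsto_of_tendsto_of_le_of_le' tendsto_const_nhds
      (tendsto_id.mono_left nhdsWithin_le_nhds) hge hle
  · exact (hi.continuousAt (Ioi_mem_nhds h)).continuousWithinAt

lemma admS_nonempty [IsProbabilityMeasure μ] {Φ : ℝ → ℝ} (hΦ0 : Φ 0 = 0)
    (hΦmono : MonotoneOn Φ (Ici 0)) (hΦconv : ConvexOn ℝ (Ici 0) Φ)
    {α : ℝ} (hα : α ∈ Ioo (0 : ℝ) 1) {X : Ω → ℝ} (hX : MemOrlicz μ Φ X) (m : ℝ) :
    (admS μ (fun x => Φ x / (1 - α)) (fun ω => max (X ω - m) 0)).Nonempty := by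
  obtain ⟨hXm, l, hl, hfin⟩ := hX
  have hα' : 0 < 1 - α := by linarith [hα.2]
  set K := ∫⁻ ω, ENNReal.ofReal (Φ (|X ω| / l)) ∂μ with hK
  have hnn : ∀ x, 0 ≤ x → 0 ≤ Φ x := fun x hx => by
    rw [← hΦ0]; exact hΦmono (by simp) hx hx
  set c := Φ (|m| / l) with hc
  have hc0 : 0 ≤ c := hnn _ (by positivity)
  set t : ℝ := max 1 ((K.toReal + c) / (1 - α)) with ht
  have ht1 : 1 ≤ t := le_max_left _ _
  have htK : K.toReal + c ≤ t * (1 - α) := by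
    rw [← div_le_iff₀ hα']; exact le_max_right _ _
  have hs : 0 < 1 / (t * (1 - α)) := by positivity
  refine ⟨2 * t * l, by positivity, ?_⟩
  have hpt : ∀ ω, Φ (|max (X ω - m) 0| / (2 * t * l)) / (1 - α)
      ≤ (1 / (t * (1 - α))) * (Φ (|X ω| / l) + c) := by
    intro ω
    have h1 : |max (X ω - m) 0| ≤ |X ω| + |m| := by
      rw [abs_of_nonneg (le_max_right _ _)]
      apply max_le
      · linarith [le_abs_self (X ω), neg_abs_le m]
      · positivity
    have ha : 0 ≤ |X ω| / l := by positivity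
    have hb : 0 ≤ |m| / l := by positivity
    have h2 : Φ (|max (X ω - m) 0| / (2 * t * l)) ≤
        Φ ((1 / t) * ((1/2) * (|X ω| / l) + (1/2) * (|m| / l))) := by
      apply hΦmono
      · exact mem_Ici.2 (by positivity)
      · show (0:ℝ) ≤ _
        positivity
      · rw [div_le_iff₀ (by positivity)]
        have : 1 / t * (1 / 2 * (|X ω| / l) + 1 / 2 * (|m| / l)) * (2 * t * l) = |X ω| + |m| := by
          field_simp
        rw [this]; exact h1
    have hmid : 0 ≤ (1/2) * (|X ω| / l) + (1/2) * (|m| / l) := by positivity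
    have h3 := hΦconv.2 (mem_Ici.2 hmid) (show (0:ℝ) ∈ Ici 0 by simp)
      (show 0 ≤ 1 / t by positivity)
      (show 0 ≤ 1 - 1 / t by rw [sub_nonneg, div_le_one (by positivity)]; exact ht1) (by ring)
    have h4 := hΦconv.2 (mem_Ici.2 ha) (mem_Ici.2 hb)
      (show (0:ℝ) ≤ 1/2 by norm_num) (show (0:ℝ) ≤ 1/2 by norm_num) (by norm_num)
    simp only [smul_eq_mul, mul_zero, add_zero, hΦ0] at h3 h4
    have h5 : Φ (|max (X ω - m) 0| / (2 * t * l)) ≤ (1 / t) * (Φ (|X ω| / l) + c) := by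
      refine h2.trans (h3.trans (mul_le_mul_of_nonneg_left ?_ (by positivity)))
      have := hnn _ ha
      linarith
    calc _ ≤ ((1 / t) * (Φ (|X ω| / l) + c)) / (1 - α) := by gcongr
      _ = _ := by field_simp
  calc ∫⁻ ω, ENNReal.ofReal (Φ (|max (X ω - m) 0| / (2 * t * l)) / (1 - α)) ∂μ
      ≤ ∫⁻ ω, ENNReal.ofReal (1 / (t * (1 - α))) *
          (ENNReal.ofReal (Φ (|X ω| / l)) + ENNReal.ofReal c) ∂μ := by
        apply lintegral_mono
        intro ω
        beta_reduce
        rw [← ENNReal.ofReal_add (hnn _ (by positivity)) hc0, ← ENNReal.ofReal_mul hs.le]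
        exact ENNReal.ofReal_le_ofReal (hpt ω)
    _ = ENNReal.ofReal (1 / (t * (1 - α))) * (K + ENNReal.ofReal c) := by
        rw [lintegral_const_mul' _ _ ENNReal.ofReal_ne_top, lintegral_add_right _ measurable_const]
        simp [hK]
    _ ≤ 1 := by
        rw [← ENNReal.ofReal_toReal hfin.ne, ← ENNReal.ofReal_add ENNReal.toReal_nonneg hc0,
          ← ENNReal.ofReal_mul hs.le, ← ENNReal.ofReal_one]
        apply ENNReal.ofReal_le_ofReal
        rw [one_div, inv_mul_le_iff₀ (by positivity)]
        linarith

lemma coercive_aux [IsProbabilityMeasure μ] {Θ : ℝ → ℝ}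
    (hm : MonotoneOn Θ (Ici 0)) (hcont : ContinuousOn Θ (Ici 0)) (h1 : 1 < Θ 1)
    {X : Ω → ℝ} (hX : Measurable X) :
    ∃ r k : ℝ, 0 < k ∧ k < 1 ∧ ∀ m l, l ∈ admS μ Θ (fun ω => max (X ω - m) 0) →
      -r - m ≤ k * l := by
  have hc1 : ContinuousAt Θ 1 := hcont.continuousAt (Ici_mem_nhds one_pos)
  have he : ∀ᶠ x in 𝓝[<] (1:ℝ), 1 < Θ x :=
    nhdsWithin_le_nhds (hc1.eventually (lt_mem_nhds h1))
  have he2 : ∀ᶠ x in 𝓝[<] (1:ℝ), 0 < x := nhdsWithin_le_nhds (lt_mem_nhds one_pos)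
  obtain ⟨k, ⟨hk, hk0⟩, hk1⟩ := ((he.and he2).and self_mem_nhdsWithin).exists
  have hA : Tendsto (fun j : ℕ => μ {ω | -(j:ℝ) ≤ X ω}) atTop (𝓝 (μ univ)) := by
    have : (⋃ j : ℕ, {ω | -(j:ℝ) ≤ X ω}) = univ := by
      ext ω
      simp only [mem_iUnion, mem_ofPred_eq, mem_univ, iff_true]
      obtain ⟨j, hj⟩ := exists_nat_ge (-X ω)
      exact ⟨j, by linarith⟩
    rw [← this]
    apply tendsto_measure_iUnion_atTop
    intro i j hij ω hω
    have : (i:ℝ) ≤ j := by exact_mod_cast hij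
    simp only [mem_ofPred_eq] at hω ⊢
    linarith
  have hA2 : Tendsto (fun j : ℕ => μ {ω | -(j:ℝ) ≤ X ω} * ENNReal.ofReal (Θ k)) atTop
      (𝓝 (μ univ * ENNReal.ofReal (Θ k))) :=
    ENNReal.Tendsto.mul_const hA (Or.inr ENNReal.ofReal_ne_top)
  rw [measure_univ, one_mul] at hA2
  have h1k : (1 : ENNReal) < ENNReal.ofReal (Θ k) := by
    rw [← ENNReal.ofReal_one]; exact (ENNReal.ofReal_lt_ofReal_iff (by linarith)).2 hk
  obtain ⟨j, hj⟩ := (hA2.eventually (lt_mem_nhds h1k)).exists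
  refine ⟨j, k, hk0, hk1, ?_⟩
  intro m l hl
  by_contra hcon
  push Not at hcon
  have hl0 := hl.1
  refine absurd hl.2 (not_le.2 (hj.trans_le ?_))
  have hms : MeasurableSet {ω | -(j:ℝ) ≤ X ω} := measurableSet_le measurable_const hX
  rw [mul_comm, ← lintegral_indicator_const hms]
  apply lintegral_mono
  intro ω
  by_cases hω : ω ∈ {ω | -(j:ℝ) ≤ X ω}
  · simp only [indicator_of_mem hω]
    apply ENNReal.ofReal_le_ofReal
    apply hm hk0.le
    · exact div_nonneg (abs_nonneg _) hl0.le
    · rw [le_div_iff₀ hl0]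
      simp only [mem_ofPred_eq] at hω
      have := le_max_left (X ω - m) 0
      have := le_abs_self (max (X ω - m) 0)
      linarith
  · simp [indicator_of_notMem hω]

end aux

/-- `π_α` is continuous from below: if `(X_n) ⊂ L^Φ` is nondecreasing and converges a.s.
to `X ∈ L^Φ`, then `π_α(X_n) → π_α(X)`. -/
theorem stmt_7 {Ω : Type*} [MeasurableSpace Ω] (μ : Measure Ω) [IsProbabilityMeasure μ]
    (hNA : ∀ A : Set Ω, MeasurableSet A → 0 < μ A →
      ∃ B : Set Ω, B ⊆ A ∧ MeasurableSet B ∧ 0 < μ B ∧ μ B < μ A)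
    (Φ : ℝ → ℝ) (hΦ0 : Φ 0 = 0) (hΦ1 : Φ 1 = 1)
    (hΦmono : MonotoneOn Φ (Ici 0)) (hΦconv : ConvexOn ℝ (Ici 0) Φ)
    (α : ℝ) (hα : α ∈ Ioo (0 : ℝ) 1)
    (Xn : ℕ → Ω → ℝ) (X : Ω → ℝ)
    (hXn : ∀ n, MemOrlicz μ Φ (Xn n)) (hX : MemOrlicz μ Φ X)
    (hmono : ∀ᵐ ω ∂μ, Monotone fun n => Xn n ω)
    (hconv : ∀ᵐ ω ∂μ, Tendsto (fun n => Xn n ω) atTop (𝓝 (X ω))) :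
    Tendsto (fun n => piHG μ Φ α (Xn n)) atTop (𝓝 (piHG μ Φ α X)) := by
  have hα' : 0 < 1 - α := by linarith [hα.2]
  set Θ : ℝ → ℝ := fun x => Φ x / (1 - α) with hΘ
  have hΘm : MonotoneOn Θ (Ici 0) := fun x hx y hy hxy =>
    div_le_div_of_nonneg_right (hΦmono hx hy hxy) hα'.le
  have hΘc : ContinuousOn Θ (Ici 0) := (cont_aux hΦ0 hΦ1 hΦmono hΦconv).div_const _
  have hΘ1 : 1 < Θ 1 := by
    simp only [hΘ, hΦ1]
    rw [lt_div_iff₀ hα']; linarith [hα.1]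
  have hne : ∀ n m, (admS μ Θ (fun ω => max (Xn n ω - m) 0)).Nonempty := fun n m =>
    admS_nonempty hΦ0 hΦmono hΦconv hα (hXn n) m
  have hneX : ∀ m, (admS μ Θ (fun ω => max (X ω - m) 0)).Nonempty := fun m =>
    admS_nonempty hΦ0 hΦmono hΦconv hα hX m
  have hbdd : ∀ Y : Ω → ℝ, MemOrlicz μ Φ Y →
      BddBelow (range fun m : ℝ => m + luxNorm μ Θ (fun ω => max (Y ω - m) 0)) := by
    intro Y hY
    obtain ⟨r, k, hk0, hk1, hrk⟩ := coercive_aux (μ := μ) hΘm hΘc hΘ1 hY.1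
    refine ⟨-r, ?_⟩
    rintro _ ⟨m, rfl⟩
    have : -r - m ≤ luxNorm μ Θ (fun ω => max (Y ω - m) 0) := by
      refine le_csInf (admS_nonempty hΦ0 hΦmono hΦconv hα hY m) ?_
      intro l hl
      have h1 := hrk m l hl
      have h2 := hl.1
      nlinarith
    show -r ≤ m + _
    linarith
  have habs : ∀ {a b m : ℝ}, a ≤ b → |max (a - m) 0| ≤ |max (b - m) 0| := by
    intro a b m h
    rw [abs_of_nonneg (le_max_right _ _), abs_of_nonneg (le_max_right _ _)]
    exact max_le_max (by linarith) le_rfl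
  have hpi : ∀ Y Z : Ω → ℝ, MemOrlicz μ Φ Y → MemOrlicz μ Φ Z → (∀ᵐ ω ∂μ, Y ω ≤ Z ω) →
      piHG μ Φ α Y ≤ piHG μ Φ α Z := by
    intro Y Z hY hZ hYZ
    refine ciInf_mono (hbdd Y hY) fun m => ?_
    have : luxNorm μ Θ (fun ω => max (Y ω - m) 0) ≤ luxNorm μ Θ (fun ω => max (Z ω - m) 0) := by
      refine le_csInf (admS_nonempty hΦ0 hΦmono hΦconv hα hZ m) fun l hl => ?_
      exact lux_le_aux (admS_mono hΘm (hYZ.mono fun ω h => habs h) hl le_rfl)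
    show m + luxNorm μ Θ _ ≤ m + luxNorm μ Θ _
    linarith
  have hleX : ∀ n, ∀ᵐ ω ∂μ, Xn n ω ≤ X ω := by
    intro n
    filter_upwards [hmono, hconv] with ω h1 h2
    exact h1.ge_of_tendsto h2 n
  have hmon : Monotone fun n => piHG μ Φ α (Xn n) := fun i j hij =>
    hpi _ _ (hXn i) (hXn j) (hmono.mono fun ω h => h hij)
  refine tendsto_order.2 ⟨fun b hb => ?_, fun b hb => Eventually.of_forall fun n =>
    (hpi _ _ (hXn n) hX (hleX n)).trans_lt hb⟩
  by_contra hcon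
  have hall : ∀ n, piHG μ Φ α (Xn n) ≤ b := by
    intro n
    by_contra hn
    push Not at hn
    exact hcon (eventually_atTop.2 ⟨n, fun j hj => hn.trans_le (hmon hj)⟩)
  obtain ⟨L, hbL, hL⟩ := exists_between hb
  have hex : ∀ n, ∃ m : ℝ, L - m ∈ admS μ Θ (fun ω => max (Xn n ω - m) 0) := by
    intro n
    obtain ⟨m, hm⟩ := exists_lt_of_ciInf_lt ((hall n).trans_lt hbL)
    refine ⟨m, admS_of_lt hΘm (hne n m) ?_⟩
    change m + luxNorm μ Θ _ < L at hm
    linarith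
  choose M hM using hex
  obtain ⟨r, k, hk0, hk1, hrk⟩ := coercive_aux (μ := μ) hΘm hΘc hΘ1 (hXn 0).1
  have hMmem : ∀ n, M n ∈ Icc (-(k * L + r) / (1 - k)) L := by
    intro n
    have h1 := hrk (M n) (L - M n) (admS_mono hΘm
      (hmono.mono fun ω h => habs (h (Nat.zero_le n))) (hM n) le_rfl)
    have h2 := (hM n).1
    refine ⟨?_, by linarith⟩
    rw [div_le_iff₀ (by linarith)]
    nlinarith
  obtain ⟨m, -, φ, hφ, hφm⟩ := isCompact_Icc.tendsto_subseq hMmem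
  have hkey : ∀ l', L - m < l' → 0 < l' → l' ∈ admS μ Θ (fun ω => max (X ω - m) 0) := by
    intro l' hl' hl0
    refine ⟨hl0, ?_⟩
    have hev : ∀ᶠ n in atTop, l' ∈ admS μ Θ (fun ω => max (Xn (φ n) ω - M (φ n)) 0) := by
      have : Tendsto (fun n => L - M (φ n)) atTop (𝓝 (L - m)) := hφm.const_sub L
      filter_upwards [this.eventually (gt_mem_nhds hl')] with n hn
      exact admS_mono hΘm (Eventually.of_forall fun _ => le_rfl) (hM (φ n)) hn.le
    have hcomp : Continuous fun x : ℝ => Θ (|max x 0| / l') := by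
      have : Continuous fun x : ℝ => |max x 0| / l' := by fun_prop
      exact hΘc.comp_continuous this fun x => div_nonneg (abs_nonneg _) hl0.le
    have hcomp' : Continuous fun x : ℝ => ENNReal.ofReal (Θ (|max x 0| / l')) :=
      ENNReal.continuous_ofReal.comp hcomp
    calc ∫⁻ ω, ENNReal.ofReal (Θ (|max (X ω - m) 0| / l')) ∂μ
        = ∫⁻ ω, liminf (fun n =>
            ENNReal.ofReal (Θ (|max (Xn (φ n) ω - M (φ n)) 0| / l'))) atTop ∂μ := by
          apply lintegral_congr_ae
          filter_upwards [hconv] with ω hω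
          refine (Tendsto.liminf_eq ?_).symm
          exact (hcomp'.tendsto _).comp ((hω.comp hφ.tendsto_atTop).sub hφm)
      _ ≤ liminf (fun n => ∫⁻ ω,
            ENNReal.ofReal (Θ (|max (Xn (φ n) ω - M (φ n)) 0| / l')) ∂μ) atTop := by
          apply lintegral_liminf_le
          intro n
          exact hcomp'.measurable.comp ((hXn (φ n)).1.sub_const _)
      _ ≤ 1 := by
          refine (liminf_le_liminf (hev.mono fun n hn => hn.2)).trans ?_
          simp
  have hmL : m ≤ L := le_of_tendsto hφm (Eventually.of_forall fun n => (hMmem (φ n)).2)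
  have hN : luxNorm μ Θ (fun ω => max (X ω - m) 0) ≤ L - m := by
    refine le_of_forall_gt_imp_ge_of_dense fun l' hl' => lux_le_aux (hkey l' hl' ?_)
    linarith
  have : piHG μ Φ α X ≤ m + luxNorm μ Θ (fun ω => max (X ω - m) 0) := ciInf_le (hbdd X hX) m
  linarith
end

section
/- The Haezendonck–Goovaerts premium principle π_α satisfies the Fatou property: for every sequence (X_n) ⊂ L^Φ with sup_n |X_n| ∈ L^Φ and every X ∈ L^Φ, if X_n → X almost surely then π_α(X) ≤ liminf_n π_α(X_n). -/
open MeasureTheory Filter Set Topology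

lemma hg_psi_convex (Φ : ℝ → ℝ) (hΦmono : MonotoneOn Φ (Ici 0))
    (hΦconv : ConvexOn ℝ (Ici 0) Φ) : ConvexOn ℝ univ (fun x => Φ (max x 0)) := by
  refine ⟨convex_univ, fun x _ y _ a b ha hb hab => ?_⟩
  have hx : max x 0 ∈ Ici (0:ℝ) := mem_Ici.mpr (le_max_right _ _)
  have hy : max y 0 ∈ Ici (0:ℝ) := mem_Ici.mpr (le_max_right _ _)
  refine le_trans (hΦmono (mem_Ici.mpr (le_max_right _ _)) (hΦconv.1 hx hy ha hb hab) ?_)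
    (hΦconv.2 hx hy ha hb hab)
  simp only [smul_eq_mul]
  have h1 := mul_le_mul_of_nonneg_left (le_max_left x 0) ha
  have h2 := mul_le_mul_of_nonneg_left (le_max_left y 0) hb
  have h3 := mul_nonneg ha (le_max_right x 0)
  have h4 := mul_nonneg hb (le_max_right y 0)
  exact max_le (by linarith) (by linarith)

lemma hg_psi_cont (Φ : ℝ → ℝ) (hΦmono : MonotoneOn Φ (Ici 0))
    (hΦconv : ConvexOn ℝ (Ici 0) Φ) : Continuous (fun x => Φ (max x 0)) := by
  have := (hg_psi_convex Φ hΦmono hΦconv).continuousOn isOpen_univ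
  exact continuousOn_univ.mp this

/-- existence of the level `t < 1` with `Φ t > 1 - α`. -/
lemma hg_exists_t (Φ : ℝ → ℝ) (hΦ1 : Φ 1 = 1) (hΦmono : MonotoneOn Φ (Ici 0))
    (hΦconv : ConvexOn ℝ (Ici 0) Φ) (α : ℝ) (hα : α ∈ Ioo (0 : ℝ) 1) :
    ∃ t : ℝ, 0 < t ∧ t < 1 ∧ 1 - α < Φ t := by
  have hc := (hg_psi_cont Φ hΦmono hΦconv).tendsto 1
  have h1 : ∀ᶠ t in 𝓝 (1:ℝ), 1 - α < Φ (max t 0) := by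
    apply hc.eventually_const_lt
    simp only [zero_le_one, sup_of_le_left, hΦ1]
    linarith [hα.1]
  have h2 : ∀ᶠ t in 𝓝[<] (1:ℝ), 1 - α < Φ (max t 0) := h1.filter_mono nhdsWithin_le_nhds
  have h3 : ∀ᶠ t in 𝓝[<] (1:ℝ), t ∈ Ioo (0:ℝ) 1 := Ioo_mem_nhdsLT one_pos
  obtain ⟨t, h, ht⟩ := (h2.and h3).exists
  rw [max_eq_left ht.1.le] at h
  exact ⟨t, ht.1, ht.2, h⟩

/-- the crucial lower bound. -/
lemma hg_lower {Ω : Type*} [MeasurableSpace Ω] (μ : Measure Ω) [IsProbabilityMeasure μ]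
    (Φ : ℝ → ℝ) (hΦmono : MonotoneOn Φ (Ici 0))
    (α : ℝ) (hα : α ∈ Ioo (0 : ℝ) 1) (t : ℝ) (ht0 : 0 < t) (ht : 1 - α < Φ t)
    (S : Ω → ℝ) (hS : Measurable S) :
    ∃ K : ℝ, ∀ Y : Ω → ℝ, (∀ᵐ ω ∂μ, |Y ω| ≤ S ω) → ∀ m l : ℝ, 0 < l →
      ∫⁻ ω, ENNReal.ofReal (Φ (|max (Y ω - m) 0| / l) / (1 - α)) ∂μ ≤ 1 → -m - K < t * l := by
  have hα1 : 0 < 1 - α := by linarith [hα.2]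
  set r := Φ t / (1 - α) with hr
  have hr1 : 1 < r := by rw [hr, one_lt_div hα1]; exact ht
  have hlim : Tendsto (fun n : ℕ => μ {ω | S ω ≤ n}) atTop (𝓝 1) := by
    have h : Monotone (fun n : ℕ => {ω | S ω ≤ n}) := by
      intro a b hab ω hω
      exact le_trans (show S ω ≤ a from hω) (by exact_mod_cast hab)
    have h2 := tendsto_measure_iUnion_atTop (μ := μ) h
    have h3 : (⋃ n : ℕ, {ω | S ω ≤ n}) = univ := by
      ext ω
      simpa using exists_nat_ge (S ω)
    rwa [h3, measure_univ] at h2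
  have hlim2 : Tendsto (fun n : ℕ => ENNReal.ofReal r * μ {ω | S ω ≤ n}) atTop
      (𝓝 (ENNReal.ofReal r * 1)) :=
    ENNReal.Tendsto.const_mul hlim (Or.inr ENNReal.ofReal_ne_top)
  have h1 : 1 < ENNReal.ofReal r * 1 := by
    rw [mul_one]; exact ENNReal.one_lt_ofReal.mpr hr1
  obtain ⟨n, hn⟩ := (hlim2.eventually_const_lt h1).exists
  refine ⟨n, fun Y hY m l hl hint => ?_⟩
  by_contra! hcon
  have hA : MeasurableSet {ω | S ω ≤ n} := measurableSet_le hS measurable_const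
  have : ENNReal.ofReal r * μ {ω | S ω ≤ n} ≤ 1 := by
    refine le_trans ?_ hint
    rw [← lintegral_indicator_const hA]
    refine lintegral_mono_ae ?_
    filter_upwards [hY] with ω hω
    by_cases hm : ω ∈ {ω | S ω ≤ n}
    · rw [indicator_of_mem hm]
      apply ENNReal.ofReal_le_ofReal
      rw [hr]
      gcongr
      have h5 : t ≤ |max (Y ω - m) 0| / l := by
        rw [le_div_iff₀ hl]
        have := (abs_le.mp hω).1
        have h6 : S ω ≤ n := hm
        exact le_trans (by linarith) (le_trans (le_max_left (Y ω - m) 0) (le_abs_self _))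
      exact hΦmono ht0.le (ht0.le.trans h5) h5
    · rw [indicator_of_notMem hm]; exact zero_le
  exact absurd hn (not_lt.mpr this)

lemma hg_nonempty {Ω : Type*} [MeasurableSpace Ω] (μ : Measure Ω) [IsProbabilityMeasure μ]
    (Φ : ℝ → ℝ) (hΦ0 : Φ 0 = 0) (hΦmono : MonotoneOn Φ (Ici 0))
    (hΦconv : ConvexOn ℝ (Ici 0) Φ)
    (α : ℝ) (hα : α ∈ Ioo (0 : ℝ) 1) (Y : Ω → ℝ) (hY : MemOrlicz μ Φ Y) (m : ℝ) :
    ∃ l : ℝ, 0 < l ∧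
      ∫⁻ ω, ENNReal.ofReal (Φ (|max (Y ω - m) 0| / l) / (1 - α)) ∂μ ≤ 1 := by
  have hα1 : 0 < 1 - α := by linarith [hα.2]
  obtain ⟨hYm, l, hl, hfin⟩ := hY
  have hpos : ∀ x : ℝ, 0 ≤ x → 0 ≤ Φ x := fun x hx => by
    rw [← hΦ0]; exact hΦmono (le_refl (0:ℝ)) hx hx
  set C := (∫⁻ ω, ENNReal.ofReal (Φ (|Y ω| / l)) ∂μ) + ENNReal.ofReal (Φ (|m| / l)) with hC
  have hCtop : C ≠ ⊤ := by
    rw [hC]; exact ENNReal.add_ne_top.mpr ⟨hfin.ne, ENNReal.ofReal_ne_top⟩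
  set r : ℝ := max 1 (C.toReal / (1 - α)) with hr
  have hr1 : 1 ≤ r := le_max_left _ _
  have hr0 : 0 < r := by linarith
  refine ⟨2 * l * r, by positivity, ?_⟩
  have key : ∀ ω, Φ (|max (Y ω - m) 0| / (2 * l * r)) / (1 - α)
      ≤ (Φ (|Y ω| / l) + Φ (|m| / l)) * (1 / (r * (1 - α))) := by
    intro ω
    have a0 : 0 ≤ |Y ω| / l := by positivity
    have b0 : 0 ≤ |m| / l := by positivity
    have h1 : |max (Y ω - m) 0| ≤ |Y ω| + |m| := by
      rw [abs_of_nonneg (le_max_right _ _)]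
      refine max_le ?_ (by positivity)
      linarith [le_abs_self (Y ω), neg_abs_le m]
    have hcv : ∀ x y a b : ℝ, 0 ≤ x → 0 ≤ y → 0 ≤ a → 0 ≤ b → a + b = 1 →
        Φ (a * x + b * y) ≤ a * Φ x + b * Φ y := fun x y a b hx hy ha hb hab =>
      hΦconv.2 (mem_Ici.mpr hx) (mem_Ici.mpr hy) ha hb hab
    have h2 : Φ (1/2 * (|Y ω| / l) + 1/2 * (|m| / l)) ≤
        1/2 * Φ (|Y ω| / l) + 1/2 * Φ (|m| / l) := by
      exact hcv _ _ _ _ a0 b0 (by norm_num) (by norm_num) (by norm_num)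
    have c0 : 0 ≤ 1/2 * (|Y ω| / l) + 1/2 * (|m| / l) := by positivity
    have hri : 1 / r ≤ 1 := by rw [div_le_one hr0]; exact hr1
    have h3 : Φ (1/r * (1/2 * (|Y ω| / l) + 1/2 * (|m| / l))) ≤
        1/r * Φ (1/2 * (|Y ω| / l) + 1/2 * (|m| / l)) := by
      have := hcv (1/2 * (|Y ω| / l) + 1/2 * (|m| / l)) 0 (1/r) (1 - 1/r) c0 le_rfl
        (by positivity) (by linarith) (by ring)
      simpa only [mul_zero, add_zero, hΦ0] using this
    have h4 : Φ (|max (Y ω - m) 0| / (2 * l * r)) ≤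
        Φ (1/r * (1/2 * (|Y ω| / l) + 1/2 * (|m| / l))) := by
      apply hΦmono
      · exact mem_Ici.mpr (div_nonneg (abs_nonneg _) (by positivity))
      · exact mem_Ici.mpr (mul_nonneg (by positivity) c0)
      · have : 1/r * (1/2 * (|Y ω| / l) + 1/2 * (|m| / l)) = (|Y ω| + |m|) / (2 * l * r) := by
          field_simp
        rw [this]
        gcongr
    have hA := hpos _ a0
    have hB := hpos _ b0
    have h5 : Φ (|max (Y ω - m) 0| / (2 * l * r)) ≤ 1/r * (Φ (|Y ω| / l) + Φ (|m| / l)) := by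
      refine h4.trans (h3.trans ?_)
      gcongr
      linarith
    calc _ ≤ (1/r * (Φ (|Y ω| / l) + Φ (|m| / l))) / (1 - α) := by gcongr
      _ = _ := by field_simp
  calc ∫⁻ ω, ENNReal.ofReal (Φ (|max (Y ω - m) 0| / (2 * l * r)) / (1 - α)) ∂μ
      ≤ ∫⁻ ω, (ENNReal.ofReal (Φ (|Y ω| / l)) + ENNReal.ofReal (Φ (|m| / l))) *
          ENNReal.ofReal (1 / (r * (1 - α))) ∂μ := by
        refine lintegral_mono fun ω => ?_
        refine (ENNReal.ofReal_le_ofReal (key ω)).trans ?_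
        have hA := hpos (|Y ω| / l) (by positivity)
        have hB := hpos (|m| / l) (by positivity)
        rw [ENNReal.ofReal_mul (by linarith), ENNReal.ofReal_add hA hB]
    _ = C * ENNReal.ofReal (1 / (r * (1 - α))) := by
        rw [lintegral_mul_const' _ _ ENNReal.ofReal_ne_top,
          lintegral_add_right _ measurable_const, lintegral_const, measure_univ, mul_one]
    _ ≤ 1 := by
        rw [← ENNReal.ofReal_toReal hCtop, ← ENNReal.ofReal_mul ENNReal.toReal_nonneg]
        rw [← ENNReal.ofReal_one]
        apply ENNReal.ofReal_le_ofReal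
        rw [mul_one_div, div_le_one (by positivity), ← div_le_iff₀ hα1]
        exact le_max_right _ _

/-- `π_α` satisfies the Fatou property: if `(X_n) ⊂ L^Φ` is dominated by
`sup_n |X_n| ∈ L^Φ` and converges a.s. to `X ∈ L^Φ`, then
`π_α(X) ≤ liminf_n π_α(X_n)`. -/
theorem stmt_8 {Ω : Type*} [MeasurableSpace Ω] (μ : Measure Ω) [IsProbabilityMeasure μ]
    (hNA : ∀ A : Set Ω, MeasurableSet A → 0 < μ A →
      ∃ B : Set Ω, B ⊆ A ∧ MeasurableSet B ∧ 0 < μ B ∧ μ B < μ A)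
    (Φ : ℝ → ℝ) (hΦ0 : Φ 0 = 0) (hΦ1 : Φ 1 = 1)
    (hΦmono : MonotoneOn Φ (Ici 0)) (hΦconv : ConvexOn ℝ (Ici 0) Φ)
    (α : ℝ) (hα : α ∈ Ioo (0 : ℝ) 1)
    (Xn : ℕ → Ω → ℝ) (X : Ω → ℝ) (S : Ω → ℝ)
    (hXn : ∀ n, MemOrlicz μ Φ (Xn n)) (hX : MemOrlicz μ Φ X)
    (hS : MemOrlicz μ Φ S) (hdom : ∀ n, ∀ᵐ ω ∂μ, |Xn n ω| ≤ S ω)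
    (hconv : ∀ᵐ ω ∂μ, Tendsto (fun n => Xn n ω) atTop (𝓝 (X ω))) :
    ((piHG μ Φ α X : ℝ) : EReal)
      ≤ Filter.liminf (fun n => ((piHG μ Φ α (Xn n) : ℝ) : EReal)) atTop := by
  have hα1 : 0 < 1 - α := by linarith [hα.2]
  obtain ⟨t, ht0, ht1, ht⟩ := hg_exists_t Φ hΦ1 hΦmono hΦconv α hα
  obtain ⟨K, hK⟩ := hg_lower μ Φ hΦmono α hα t ht0 ht S hS.1
  have hXS : ∀ᵐ ω ∂μ, |X ω| ≤ S ω := by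
    filter_upwards [hconv, ae_all_iff.mpr hdom] with ω h1 h2
    exact le_of_tendsto h1.abs (Eventually.of_forall h2)
  -- the objective is bounded below at `X`
  have hbdd : BddBelow (range fun m : ℝ =>
      m + luxNorm μ (fun x => Φ x / (1 - α)) (fun ω => max (X ω - m) 0)) := by
    refine ⟨-K, ?_⟩
    rintro _ ⟨m, rfl⟩
    have : -m - K ≤ luxNorm μ (fun x => Φ x / (1 - α)) (fun ω => max (X ω - m) 0) := by
      refine le_csInf (hg_nonempty μ Φ hΦ0 hΦmono hΦconv α hα X hX m) ?_
      rintro l ⟨hl, hint⟩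
      have := hK X hXS m l hl hint
      nlinarith
    dsimp only
    linarith
  by_contra! hcon
  obtain ⟨c, hc1, hc2⟩ := EReal.lt_iff_exists_real_btwn.mp hcon
  have hc2' : c < piHG μ Φ α X := by exact_mod_cast hc2
  have hfreq := frequently_lt_of_liminf_lt (by isBoundedDefault) hc1
  obtain ⟨φ, hφ, hφc⟩ := extraction_of_frequently_atTop hfreq
  have hex : ∀ k, ∃ p : ℝ × ℝ, 0 < p.2 ∧ p.1 + p.2 < c ∧
      ∫⁻ ω, ENNReal.ofReal (Φ (|max (Xn (φ k) ω - p.1) 0| / p.2) / (1 - α)) ∂μ ≤ 1 := by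
    intro k
    have h1 : piHG μ Φ α (Xn (φ k)) < c := by exact_mod_cast hφc k
    obtain ⟨m, hm⟩ := exists_lt_of_ciInf_lt h1
    have h2 : luxNorm μ (fun x => Φ x / (1 - α)) (fun ω => max (Xn (φ k) ω - m) 0) < c - m := by
      linarith
    obtain ⟨l, ⟨hl, hint⟩, hlc⟩ := exists_lt_of_csInf_lt
      (hg_nonempty μ Φ hΦ0 hΦmono hΦconv α hα (Xn (φ k)) (hXn _) m) h2
    exact ⟨(m, l), hl, by dsimp only; linarith, hint⟩
  choose p hp0 hpc hpint using hex
  have hlow : ∀ k, -(K + t * c) / (1 - t) ≤ (p k).1 := by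
    intro k
    have := hK _ (hdom (φ k)) (p k).1 (p k).2 (hp0 k) (hpint k)
    have h2 := hpc k
    rw [div_le_iff₀ (by linarith)]
    nlinarith
  set M := -(K + t * c) / (1 - t) with hM
  have hmem : ∀ k, p k ∈ Icc M c ×ˢ Icc 0 (c - M) := by
    intro k
    have h1 := hlow k
    have h2 := hpc k
    have h3 := hp0 k
    exact ⟨⟨h1, by linarith⟩, ⟨h3.le, by linarith⟩⟩
  obtain ⟨q, hq, ψ, hψ, hlim⟩ := (isCompact_Icc.prod isCompact_Icc).tendsto_subseq hmem
  have hlim1 : Tendsto (fun k => (p (ψ k)).1) atTop (𝓝 q.1) :=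
    (continuous_fst.tendsto q).comp hlim
  have hlim2 : Tendsto (fun k => (p (ψ k)).2) atTop (𝓝 q.2) :=
    (continuous_snd.tendsto q).comp hlim
  have hqc : q.1 + q.2 ≤ c :=
    le_of_tendsto (hlim1.add hlim2) (Eventually.of_forall fun k => (hpc (ψ k)).le)
  have hq0 : 0 ≤ q.2 := hq.2.1
  set ε := (piHG μ Φ α X - c) / 2 with hε
  have hε0 : 0 < ε := by rw [hε]; linarith
  have hcont := hg_psi_cont Φ hΦmono hΦconv
  have hΨ : ∀ x : ℝ, 0 ≤ x → Φ (max x 0) = Φ x := fun x hx => by rw [max_eq_left hx]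
  have hfatou : ∫⁻ ω, ENNReal.ofReal (Φ (|max (X ω - q.1) 0| / (q.2 + ε)) / (1 - α)) ∂μ ≤ 1 := by
    let F : ℕ → Ω → ENNReal := fun k ω => ENNReal.ofReal
      (Φ (max (|max (Xn (φ (ψ k)) ω - (p (ψ k)).1) 0| / ((p (ψ k)).2 + ε)) 0) / (1 - α))
    have hFm : ∀ k, Measurable (F k) := by
      intro k
      have hm := (hXn (φ (ψ k))).1
      have h1 : Measurable fun ω =>
          |max (Xn (φ (ψ k)) ω - (p (ψ k)).1) 0| / ((p (ψ k)).2 + ε) :=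
        (((hm.sub_const _).max measurable_const).abs).div_const _
      exact ((hcont.measurable.comp h1).div_const _).ennreal_ofReal
    have hF1 : ∀ k, ∫⁻ ω, F k ω ∂μ ≤ 1 := by
      intro k
      refine le_trans (lintegral_mono fun ω => ?_) (hpint (ψ k))
      have hl := hp0 (ψ k)
      apply ENNReal.ofReal_le_ofReal
      have hle : |max (Xn (φ (ψ k)) ω - (p (ψ k)).1) 0| / ((p (ψ k)).2 + ε) ≤
          |max (Xn (φ (ψ k)) ω - (p (ψ k)).1) 0| / (p (ψ k)).2 := by
        apply div_le_div_of_nonneg_left (abs_nonneg _) hl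
        linarith
      have h0 : 0 ≤ |max (Xn (φ (ψ k)) ω - (p (ψ k)).1) 0| / ((p (ψ k)).2 + ε) :=
        div_nonneg (abs_nonneg _) (by linarith)
      rw [hΨ _ h0]
      exact div_le_div_of_nonneg_right (hΦmono h0 (h0.trans hle) hle) hα1.le
    have hFlim : ∀ᵐ ω ∂μ, ENNReal.ofReal (Φ (|max (X ω - q.1) 0| / (q.2 + ε)) / (1 - α))
        = liminf (fun k => F k ω) atTop := by
      filter_upwards [hconv] with ω hω
      symm
      apply Tendsto.liminf_eq
      have h1 : Tendsto (fun k => Xn (φ (ψ k)) ω) atTop (𝓝 (X ω)) :=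
        hω.comp (hφ.tendsto_atTop.comp hψ.tendsto_atTop)
      have h2 : Tendsto (fun k => |max (Xn (φ (ψ k)) ω - (p (ψ k)).1) 0| / ((p (ψ k)).2 + ε))
          atTop (𝓝 (|max (X ω - q.1) 0| / (q.2 + ε))) :=
        (((h1.sub hlim1).max tendsto_const_nhds).abs).div (hlim2.add_const ε) (by linarith)
      have h3 := (hcont.tendsto _).comp h2
      rw [← hΨ (|max (X ω - q.1) 0| / (q.2 + ε)) (div_nonneg (abs_nonneg _) (by linarith))]
      exact ENNReal.tendsto_ofReal (h3.div_const (1 - α))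
    rw [lintegral_congr_ae hFlim]
    refine (lintegral_liminf_le hFm).trans ?_
    exact liminf_le_of_le (by isBoundedDefault) fun b hb => by
      obtain ⟨k, hk⟩ := hb.exists
      exact hk.trans (hF1 k)
  have hN : luxNorm μ (fun x => Φ x / (1 - α)) (fun ω => max (X ω - q.1) 0) ≤ q.2 + ε :=
    csInf_le ⟨0, fun l hl => hl.1.le⟩ ⟨by linarith, hfatou⟩
  have hfin : piHG μ Φ α X ≤ q.1 + luxNorm μ (fun x => Φ x / (1 - α))
      (fun ω => max (X ω - q.1) 0) := ciInf_le hbdd q.1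
  have : piHG μ Φ α X ≤ c + ε := by linarith
  rw [hε] at this
  linarith
end

section
/- For the Haezendonck–Goovaerts premium principle π_α the following three statements are equivalent: (i) π_α is continuous from above, i.e. for every nonincreasing sequence (X_n) ⊂ L^Φ converging almost surely to X ∈ L^Φ one has π_α(X_n) → π_α(X); (ii) π_α satisfies the Lebesgue property, i.e. for every sequence (X_n) ⊂ L^Φ with sup_n |X_n| ∈ L^Φ and every X ∈ L^Φ, X_n → X almost surely implies π_α(X_n) → π_α(X); (iii) Φ satisfies the Δ₂ condition. -/
open MeasureTheory Filter Set Topology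

theorem aux_small {Ω : Type*} [MeasurableSpace Ω] (μ : Measure Ω) [IsProbabilityMeasure μ]
    (hNA : ∀ A : Set Ω, MeasurableSet A → 0 < μ A →
      ∃ B : Set Ω, B ⊆ A ∧ MeasurableSet B ∧ 0 < μ B ∧ μ B < μ A)
    (A : Set Ω) (hA : MeasurableSet A) (hpos : 0 < μ.real A) (n : ℕ) :
    ∃ B : Set Ω, B ⊆ A ∧ MeasurableSet B ∧ 0 < μ.real B ∧ μ.real B ≤ μ.real A / 2 ^ n := by
  induction n with
  | zero => exact ⟨A, subset_rfl, hA, hpos, by simp⟩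
  | succ n ih =>
    obtain ⟨B, hBA, hB, hB0, hBn⟩ := ih
    obtain ⟨C, hCB, hC, hC0, hC1⟩ := hNA B hB (by
      have := (ENNReal.toReal_pos_iff.1 hB0).1
      exact this)
    have hC0' : 0 < μ.real C := ENNReal.toReal_pos hC0.ne' (measure_ne_top _ _)
    have hC1' : μ.real C < μ.real B :=
      (ENNReal.toReal_lt_toReal (measure_ne_top _ _) (measure_ne_top _ _)).2 hC1
    have hd : μ.real (B \ C) = μ.real B - μ.real C := measureReal_sdiff hCB hC
    have e : μ.real A / 2 ^ (n + 1) = (μ.real A / 2 ^ n) / 2 := by rw [pow_succ]; field_simp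
    rcases le_total (μ.real C) (μ.real B / 2) with h | h
    · exact ⟨C, hCB.trans hBA, hC, hC0', by rw [e]; linarith⟩
    · exact ⟨B \ C, sdiff_subset.trans hBA, hB.diff hC, by rw [hd]; linarith,
        by rw [e, hd]; linarith⟩

theorem aux_step {Ω : Type*} [MeasurableSpace Ω] (μ : Measure Ω) [IsProbabilityMeasure μ]
    (p : ℝ) (C : Set Ω) (hC : MeasurableSet C) (hCp : μ.real C ≤ p) :
    ∃ C' : Set Ω, C ⊆ C' ∧ MeasurableSet C' ∧ μ.real C' ≤ p ∧
      ∀ D : Set Ω, C ⊆ D → MeasurableSet D → μ.real D ≤ p →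
        μ.real D - μ.real C ≤ 2 * (μ.real C' - μ.real C) := by
  by_contra! H
  set S : Set ℝ := {x | ∃ D : Set Ω, C ⊆ D ∧ MeasurableSet D ∧ μ.real D ≤ p ∧ μ.real D = x} with hS
  have hbdd : BddAbove S := ⟨p, by rintro x ⟨D, -, -, h, rfl⟩; exact h⟩
  have hCS : μ.real C ∈ S := ⟨C, subset_rfl, hC, hCp, rfl⟩
  obtain ⟨D, h1, h2, h3, h4⟩ := H C subset_rfl hC hCp
  have hDs : μ.real D ≤ sSup S := le_csSup hbdd ⟨D, h1, h2, h3, rfl⟩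
  obtain ⟨x, ⟨E, e1, e2, e3, rfl⟩, hx⟩ := exists_lt_of_lt_csSup ⟨_, hCS⟩
    (show (sSup S + μ.real C) / 2 < sSup S by linarith)
  obtain ⟨F, f1, f2, f3, f4⟩ := H E e1 e2 e3
  have hFs : μ.real F ≤ sSup S := le_csSup hbdd ⟨F, f1, f2, f3, rfl⟩
  linarith

theorem aux_sierpinski {Ω : Type*} [MeasurableSpace Ω] (μ : Measure Ω) [IsProbabilityMeasure μ]
    (hNA : ∀ A : Set Ω, MeasurableSet A → 0 < μ A →
      ∃ B : Set Ω, B ⊆ A ∧ MeasurableSet B ∧ 0 < μ B ∧ μ B < μ A)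
    (p : ℝ) (hp0 : 0 ≤ p) (hp1 : p ≤ 1) :
    ∃ B : Set Ω, MeasurableSet B ∧ μ.real B = p := by
  classical
  let T := {C : Set Ω // MeasurableSet C ∧ μ.real C ≤ p}
  have step : ∀ C : T, ∃ C' : T, C.1 ⊆ C'.1 ∧
      ∀ D : Set Ω, C.1 ⊆ D → MeasurableSet D → μ.real D ≤ p →
        μ.real D - μ.real C.1 ≤ 2 * (μ.real C'.1 - μ.real C.1) := by
    rintro ⟨C, hC, hCp⟩
    obtain ⟨C', h1, h2, h3, h4⟩ := aux_step μ p C hC hCp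
    exact ⟨⟨C', h2, h3⟩, h1, h4⟩
  choose f hf1 hf2 using step
  let c : ℕ → T := fun n => f^[n] ⟨∅, MeasurableSet.empty, by simpa using hp0⟩
  have hc : ∀ n, c (n + 1) = f (c n) := fun n => Function.iterate_succ_apply' _ _ _
  have hmono : Monotone fun n => (c n).1 := monotone_nat_of_le_succ fun n => by
    rw [hc]; exact hf1 _
  have hlim : Tendsto (fun n => μ.real (c n).1) atTop (𝓝 (μ.real (⋃ n, (c n).1))) :=
    (ENNReal.tendsto_toReal (measure_ne_top _ _)).comp (tendsto_measure_iUnion_atTop hmono)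
  have hmeas : MeasurableSet (⋃ n, (c n).1) := MeasurableSet.iUnion fun n => (c n).2.1
  have hle : μ.real (⋃ n, (c n).1) ≤ p := le_of_tendsto' hlim fun n => (c n).2.2
  refine ⟨_, hmeas, le_antisymm hle ?_⟩
  by_contra! hlt
  have hcompl : μ.real (⋃ n, (c n).1)ᶜ = 1 - μ.real (⋃ n, (c n).1) := probReal_compl_eq_one_sub hmeas
  obtain ⟨n, hn⟩ := exists_pow_lt_of_lt_one (sub_pos.2 hlt) (show (1/2 : ℝ) < 1 by norm_num)
  obtain ⟨D, d1, d2, d3, d4⟩ := aux_small μ hNA _ hmeas.compl (by rw [hcompl]; linarith) n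
  have d5 : μ.real D ≤ p - μ.real (⋃ n, (c n).1) := by
    refine d4.trans (le_trans ?_ hn.le)
    rw [one_div, inv_pow, ← one_div]
    gcongr
    exact measureReal_le_one
  have key : ∀ k, μ.real D ≤ 2 * (μ.real (c (k + 1)).1 - μ.real (c k).1) := by
    intro k
    have hdisj : Disjoint (c k).1 D := by
      refine Set.disjoint_left.2 fun x hx hD => d1 hD (mem_iUnion.2 ⟨k, hx⟩)
    have hu : μ.real ((c k).1 ∪ D) = μ.real (c k).1 + μ.real D := measureReal_union hdisj d2
    have hk : μ.real (c k).1 ≤ μ.real (⋃ n, (c n).1) := measureReal_mono (subset_iUnion (fun n => (c n).1) k)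
    have := hf2 (c k) ((c k).1 ∪ D) subset_union_left ((c k).2.1.union d2) (by rw [hu]; linarith)
    rw [hc]; linarith
  have hl2 : Tendsto (fun k => 2 * (μ.real (c (k + 1)).1 - μ.real (c k).1)) atTop (𝓝 (2 * (μ.real (⋃ n, (c n).1) - μ.real (⋃ n, (c n).1)))) :=
    (((tendsto_add_atTop_iff_nat 1).2 hlim).sub hlim).const_mul 2
  have := ge_of_tendsto' hl2 key
  linarith

section helpers

variable {Ω : Type*} [MeasurableSpace Ω] {μ : Measure Ω} {Θ : ℝ → ℝ}

theorem aux_meas (hm : MonotoneOn Θ (Ici 0)) {X : Ω → ℝ} (hX : Measurable X) {l : ℝ} (hl : 0 < l) :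
    Measurable fun ω => ENNReal.ofReal (Θ (|X ω| / l)) := by
  have h1 : Monotone fun x => Θ (max x 0) := fun a b hab =>
    hm (mem_Ici.2 (le_max_right _ _)) (mem_Ici.2 (le_max_right _ _)) (max_le_max_right _ hab)
  have h2 : (fun ω => ENNReal.ofReal (Θ (|X ω| / l))) =
      fun ω => ENNReal.ofReal ((fun x => Θ (max x 0)) (|X ω| / l)) := by
    funext ω
    have : 0 ≤ |X ω| / l := by positivity
    simp [max_eq_left this]
  rw [h2]
  exact (h1.measurable.comp (hX.abs.div_const l)).ennreal_ofReal

theorem aux_nonneg (h0 : Θ 0 = 0) (hm : MonotoneOn Θ (Ici 0)) {x : ℝ} (hx : 0 ≤ x) : 0 ≤ Θ x := by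
  rw [← h0]; exact hm (mem_Ici.2 le_rfl) hx hx

theorem aux_scale (h0 : Θ 0 = 0) (hc : ConvexOn ℝ (Ici 0) Θ) {x t : ℝ} (hx : 0 ≤ x) (ht : 0 ≤ t)
    (ht1 : t ≤ 1) : Θ (t * x) ≤ t * Θ x := by
  have := hc.2 (show x ∈ Ici (0:ℝ) from hx) (show (0:ℝ) ∈ Ici (0:ℝ) from mem_Ici.2 le_rfl) ht
    (sub_nonneg.2 ht1) (by ring)
  simpa [h0] using this

/-- the set defining the norm is nonempty -/
theorem aux_nonempty (h0 : Θ 0 = 0) (hm : MonotoneOn Θ (Ici 0)) (hc : ConvexOn ℝ (Ici 0) Θ)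
    {X : Ω → ℝ} (hX : MemOrlicz μ Θ X) :
    {l : ℝ | 0 < l ∧ ∫⁻ ω, ENNReal.ofReal (Θ (|X ω| / l)) ∂μ ≤ 1}.Nonempty := by
  obtain ⟨hXm, l, hl, hfin⟩ := hX
  set I := ∫⁻ ω, ENNReal.ofReal (Θ (|X ω| / l)) ∂μ with hI
  set t : ℝ := 1 / (1 + I.toReal) with ht
  have hI0 : 0 ≤ I.toReal := ENNReal.toReal_nonneg
  have ht0 : 0 < t := by positivity
  have ht1 : t ≤ 1 := by rw [ht, div_le_one (by positivity)]; linarith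
  refine ⟨l / t, by positivity, ?_⟩
  calc ∫⁻ ω, ENNReal.ofReal (Θ (|X ω| / (l / t))) ∂μ
      ≤ ∫⁻ ω, ENNReal.ofReal t * ENNReal.ofReal (Θ (|X ω| / l)) ∂μ := by
        refine lintegral_mono fun ω => ?_
        rw [← ENNReal.ofReal_mul ht0.le]
        refine ENNReal.ofReal_le_ofReal ?_
        have e : |X ω| / (l / t) = t * (|X ω| / l) := by field_simp
        rw [e]
        exact aux_scale h0 hc (by positivity) ht0.le ht1
    _ = ENNReal.ofReal t * I := lintegral_const_mul' _ _ ENNReal.ofReal_ne_top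
    _ = ENNReal.ofReal (t * I.toReal) := by
        rw [ENNReal.ofReal_mul ht0.le, ENNReal.ofReal_toReal hfin.ne]
    _ ≤ 1 := by
        rw [ENNReal.ofReal_le_one, ht, one_div, inv_mul_le_iff₀ (by positivity)]; linarith

theorem aux_bdd (X : Ω → ℝ) :
    BddBelow {l : ℝ | 0 < l ∧ ∫⁻ ω, ENNReal.ofReal (Θ (|X ω| / l)) ∂μ ≤ 1} :=
  ⟨0, fun _ h => h.1.le⟩

theorem aux_lux_nonneg (X : Ω → ℝ) : 0 ≤ luxNorm μ Θ X :=
  Real.sInf_nonneg fun _ h => h.1.le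

theorem aux_lux_add (h0 : Θ 0 = 0) (hm : MonotoneOn Θ (Ici 0)) (hc : ConvexOn ℝ (Ici 0) Θ)
    {X Y Z : Ω → ℝ} (hX : MemOrlicz μ Θ X) (hY : MemOrlicz μ Θ Y)
    (hZ : ∀ ω, |Z ω| ≤ |X ω| + |Y ω|) :
    luxNorm μ Θ Z ≤ luxNorm μ Θ X + luxNorm μ Θ Y := by
  have key : ∀ a ∈ {l : ℝ | 0 < l ∧ ∫⁻ ω, ENNReal.ofReal (Θ (|X ω| / l)) ∂μ ≤ 1},
      ∀ b ∈ {l : ℝ | 0 < l ∧ ∫⁻ ω, ENNReal.ofReal (Θ (|Y ω| / l)) ∂μ ≤ 1},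
      luxNorm μ Θ Z ≤ a + b := by
    rintro a ⟨ha, ha'⟩ b ⟨hb, hb'⟩
    refine csInf_le (aux_bdd Z) ⟨by positivity, ?_⟩
    have hs : 0 < a + b := by positivity
    calc ∫⁻ ω, ENNReal.ofReal (Θ (|Z ω| / (a + b))) ∂μ
        ≤ ∫⁻ ω, (ENNReal.ofReal (a / (a + b)) * ENNReal.ofReal (Θ (|X ω| / a)) +
            ENNReal.ofReal (b / (a + b)) * ENNReal.ofReal (Θ (|Y ω| / b))) ∂μ := by
          refine lintegral_mono fun ω => ?_
          have hx : 0 ≤ Θ (|X ω| / a) := aux_nonneg h0 hm (by positivity)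
          have hy : 0 ≤ Θ (|Y ω| / b) := aux_nonneg h0 hm (by positivity)
          rw [← ENNReal.ofReal_mul (by positivity), ← ENNReal.ofReal_mul (by positivity),
            ← ENNReal.ofReal_add (by positivity) (by positivity)]
          refine ENNReal.ofReal_le_ofReal ?_
          have e1 : |Z ω| / (a + b) ≤ a / (a + b) * (|X ω| / a) + b / (a + b) * (|Y ω| / b) := by
            have : a / (a + b) * (|X ω| / a) + b / (a + b) * (|Y ω| / b) =
              (|X ω| + |Y ω|) / (a + b) := by field_simp
            rw [this]
            gcongr
            exact hZ ω
          refine (hm (mem_Ici.2 (by positivity)) (mem_Ici.2 (by positivity)) e1).trans ?_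
          have := hc.2 (show |X ω| / a ∈ Ici (0:ℝ) from mem_Ici.2 (by positivity))
            (show |Y ω| / b ∈ Ici (0:ℝ) from mem_Ici.2 (by positivity))
            (show 0 ≤ a / (a + b) by positivity) (show 0 ≤ b / (a + b) by positivity)
            (by field_simp)
          simpa using this
      _ = ENNReal.ofReal (a / (a + b)) * ∫⁻ ω, ENNReal.ofReal (Θ (|X ω| / a)) ∂μ +
            ENNReal.ofReal (b / (a + b)) * ∫⁻ ω, ENNReal.ofReal (Θ (|Y ω| / b)) ∂μ := by
          rw [lintegral_add_left ((aux_meas hm hX.1 ha).const_mul _),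
            lintegral_const_mul' _ _ ENNReal.ofReal_ne_top,
            lintegral_const_mul' _ _ ENNReal.ofReal_ne_top]
      _ ≤ ENNReal.ofReal (a / (a + b)) * 1 + ENNReal.ofReal (b / (a + b)) * 1 := by gcongr
      _ = 1 := by
          rw [mul_one, mul_one, ← ENNReal.ofReal_add (by positivity) (by positivity)]
          rw [← add_div, div_self hs.ne', ENNReal.ofReal_one]
  have h1 : ∀ a ∈ {l : ℝ | 0 < l ∧ ∫⁻ ω, ENNReal.ofReal (Θ (|X ω| / l)) ∂μ ≤ 1},
      luxNorm μ Θ Z - a ≤ luxNorm μ Θ Y := fun a ha =>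
    le_csInf (aux_nonempty h0 hm hc hY) fun b hb => by linarith [key a ha b hb]
  have h2 : luxNorm μ Θ Z - luxNorm μ Θ Y ≤ luxNorm μ Θ X :=
    le_csInf (aux_nonempty h0 hm hc hX) fun a ha => by linarith [h1 a ha]
  linarith

theorem aux_mem_add (h0 : Θ 0 = 0) (hm : MonotoneOn Θ (Ici 0))
    {X Y Z : Ω → ℝ} (hX : MemOrlicz μ Θ X) (hY : MemOrlicz μ Θ Y) (hZm : Measurable Z)
    (hZ : ∀ ω, |Z ω| ≤ |X ω| + |Y ω|) : MemOrlicz μ Θ Z := by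
  obtain ⟨hXm, a, ha, ha'⟩ := hX
  obtain ⟨hYm, b, hb, hb'⟩ := hY
  refine ⟨hZm, a + b, by positivity, ?_⟩
  refine lt_of_le_of_lt (b := ∫⁻ ω, (ENNReal.ofReal (Θ (|X ω| / a)) +
    ENNReal.ofReal (Θ (|Y ω| / b))) ∂μ) ?_ ?_
  · refine lintegral_mono fun ω => ?_
    rcases le_total (|X ω| / a) (|Y ω| / b) with h | h
    · refine le_trans (ENNReal.ofReal_le_ofReal ?_) le_add_self
      refine hm (mem_Ici.2 (by positivity)) (mem_Ici.2 (by positivity)) ?_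
      rw [div_le_div_iff₀ ha hb] at h
      rw [div_le_div_iff₀ (by positivity) hb]
      nlinarith [hZ ω]
    · refine le_trans (ENNReal.ofReal_le_ofReal ?_) le_self_add
      refine hm (mem_Ici.2 (by positivity)) (mem_Ici.2 (by positivity)) ?_
      rw [div_le_div_iff₀ hb ha] at h
      rw [div_le_div_iff₀ (by positivity) ha]
      nlinarith [hZ ω]
  · rw [lintegral_add_left (aux_meas hm hXm ha)]
    exact ENNReal.add_lt_top.2 ⟨ha', hb'⟩

theorem aux_mem_const [IsFiniteMeasure μ] (c : ℝ) : MemOrlicz μ Θ (fun _ => c) :=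
  ⟨measurable_const, 1, one_pos, by
    rw [lintegral_const]; exact ENNReal.mul_lt_top ENNReal.ofReal_lt_top (measure_lt_top _ _)⟩

theorem aux_mem_pos [IsFiniteMeasure μ] (h0 : Θ 0 = 0) (hm : MonotoneOn Θ (Ici 0)) {X : Ω → ℝ}
    (hX : MemOrlicz μ Θ X) (m : ℝ) : MemOrlicz μ Θ (fun ω => max (X ω - m) 0) := by
  refine aux_mem_add h0 hm hX (aux_mem_const m) ((hX.1.sub_const m).max measurable_const) fun ω => ?_
  rw [abs_of_nonneg (le_max_right _ _)]
  refine max_le ?_ (by positivity)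
  linarith [le_abs_self (X ω), neg_abs_le m]

theorem aux_r (hc : ConvexOn ℝ (Ici 0) Θ) (h1 : 1 < Θ 1) : ∃ r : ℝ, 1 < r ∧ 1 < Θ (1 / r) := by
  have hcont : ContinuousOn Θ (Ioi 0) := by
    have := hc.continuousOn_interior
    simpa using this
  have hat : ContinuousAt Θ 1 := hcont.continuousAt (Ioi_mem_nhds one_pos)
  have hcomp : Tendsto (fun r : ℝ => Θ (1 / r)) (𝓝[>] 1) (𝓝 (Θ 1)) := by
    have h2 : Tendsto (fun r : ℝ => 1 / r) (𝓝 1) (𝓝 1) := by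
      have : ContinuousAt (fun r : ℝ => 1 / r) 1 := by
        fun_prop (disch := norm_num)
      simpa [ContinuousAt] using this
    exact hat.tendsto.comp (h2.mono_left nhdsWithin_le_nhds)
  obtain ⟨r, hr, hr'⟩ := ((hcomp.eventually (lt_mem_nhds h1)).and self_mem_nhdsWithin).exists
  exact ⟨r, hr', hr⟩

theorem aux_lux_lower [IsProbabilityMeasure μ] (h0 : Θ 0 = 0) (hm : MonotoneOn Θ (Ici 0))
    (hc : ConvexOn ℝ (Ici 0) Θ) {r : ℝ} (hr : 1 < r) (hr1 : 1 < Θ (1 / r))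
    {X : Ω → ℝ} (hX : MemOrlicz μ Θ X) {c : ℝ} (hcX : ∀ ω, c ≤ X ω) :
    r * c ≤ luxNorm μ Θ X := by
  refine le_csInf (aux_nonempty h0 hm hc hX) ?_
  rintro l ⟨hl, hl'⟩
  by_contra! h
  have : ENNReal.ofReal (Θ (1 / r)) ≤ 1 := by
    refine le_trans ?_ hl'
    calc ENNReal.ofReal (Θ (1 / r)) = ∫⁻ _ : Ω, ENNReal.ofReal (Θ (1 / r)) ∂μ := by simp
      _ ≤ _ := by
        refine lintegral_mono fun ω => ENNReal.ofReal_le_ofReal ?_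
        refine hm (mem_Ici.2 (by positivity)) (mem_Ici.2 (by positivity)) ?_
        rw [div_le_div_iff₀ (by positivity) hl]
        nlinarith [hcX ω, le_abs_self (X ω)]
  rw [ENNReal.ofReal_le_one] at this
  linarith

theorem aux_pi_bdd [IsProbabilityMeasure μ] (h0 : Θ 0 = 0) (hm : MonotoneOn Θ (Ici 0))
    (hc : ConvexOn ℝ (Ici 0) Θ) (h1 : 1 < Θ 1) {X : Ω → ℝ} (hX : MemOrlicz μ Θ X) :
    BddBelow (range fun m : ℝ => m + luxNorm μ Θ (fun ω => max (X ω - m) 0)) := by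
  obtain ⟨r, hr, hr1⟩ := aux_r hc h1
  refine ⟨-luxNorm μ Θ X, ?_⟩
  rintro _ ⟨m, rfl⟩
  dsimp only
  have hX0 := aux_lux_nonneg (μ := μ) (Θ := Θ) X
  have hY0 := aux_lux_nonneg (μ := μ) (Θ := Θ) (fun ω => max (X ω - m) 0)
  rcases le_total 0 m with h | h
  · linarith
  · have a1 := aux_lux_lower (μ := μ) h0 hm hc hr hr1 (aux_mem_const (-m)) (c := -m) (fun _ => le_rfl)
    have a2 := aux_lux_add h0 hm hc (aux_mem_pos h0 hm hX m) hX (Z := fun _ => -m) fun ω => by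
      rw [abs_of_nonneg (by linarith : 0 ≤ -m)]
      linarith [le_abs_self (max (X ω - m) 0), le_max_left (X ω - m) 0, neg_abs_le (X ω)]
    nlinarith

theorem aux_pi_lip [IsProbabilityMeasure μ] (h0 : Θ 0 = 0) (hm : MonotoneOn Θ (Ici 0))
    (hc : ConvexOn ℝ (Ici 0) Θ) (h1 : 1 < Θ 1) {X Y : Ω → ℝ} (hX : MemOrlicz μ Θ X)
    (hY : MemOrlicz μ Θ Y) :
    (⨅ m : ℝ, (m + luxNorm μ Θ (fun ω => max (X ω - m) 0))) ≤
      (⨅ m : ℝ, (m + luxNorm μ Θ (fun ω => max (Y ω - m) 0))) +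
        luxNorm μ Θ (fun ω => |X ω - Y ω|) := by
  rw [← sub_le_iff_le_add]
  refine le_ciInf fun m => ?_
  have a1 := ciInf_le (aux_pi_bdd h0 hm hc h1 hX) m
  have hD : MemOrlicz μ Θ (fun ω => |X ω - Y ω|) :=
    aux_mem_add h0 hm hX hY (hX.1.sub hY.1).abs fun ω => by
      rw [abs_abs]; exact abs_sub _ _
  have a2 := aux_lux_add h0 hm hc (aux_mem_pos h0 hm hY m) hD (Z := fun ω => max (X ω - m) 0)
    fun ω => by
      rw [abs_of_nonneg (le_max_right _ _), abs_of_nonneg (le_max_right _ _), abs_abs]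
      refine max_le ?_ (by positivity)
      linarith [le_abs_self (X ω - Y ω), le_max_left (Y ω - m) 0]
  linarith

theorem aux_all_finite [IsFiniteMeasure μ] (h0 : Θ 0 = 0) (hm : MonotoneOn Θ (Ici 0))
    (hΔ : ∃ y : ℝ, 0 < y ∧ ∃ k : ℝ, 0 < k ∧ ∀ x : ℝ, y ≤ x → Θ (2 * x) < k * Θ x)
    {X : Ω → ℝ} (hX : MemOrlicz μ Θ X) {l : ℝ} (hl : 0 < l) :
    ∫⁻ ω, ENNReal.ofReal (Θ (|X ω| / l)) ∂μ < ⊤ := by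
  obtain ⟨y, hy, k, hk, hyk⟩ := hΔ
  obtain ⟨hXm, a, ha, hfin⟩ := hX
  have hn : ∀ n : ℕ, ∫⁻ ω, ENNReal.ofReal (Θ (|X ω| / (a / 2 ^ n))) ∂μ < ⊤ := by
    intro n
    induction n with
    | zero => simpa using hfin
    | succ n ih =>
      refine lt_of_le_of_lt (b := ∫⁻ ω, (ENNReal.ofReal (Θ (2 * y)) +
        ENNReal.ofReal k * ENNReal.ofReal (Θ (|X ω| / (a / 2 ^ n)))) ∂μ) ?_ ?_
      · refine lintegral_mono fun ω => ?_
        have e : |X ω| / (a / 2 ^ (n + 1)) = 2 * (|X ω| / (a / 2 ^ n)) := by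
          rw [pow_succ]; field_simp
        have hx0 : 0 ≤ |X ω| / (a / 2 ^ n) := by positivity
        rw [e]
        rcases le_total y (|X ω| / (a / 2 ^ n)) with h | h
        · refine le_trans ?_ le_add_self
          rw [← ENNReal.ofReal_mul hk.le]
          exact ENNReal.ofReal_le_ofReal (hyk _ h).le
        · refine le_trans (ENNReal.ofReal_le_ofReal ?_) le_self_add
          exact hm (mem_Ici.2 (by positivity)) (mem_Ici.2 (by positivity)) (by linarith)
      · rw [lintegral_add_left measurable_const, lintegral_const,
          lintegral_const_mul' _ _ ENNReal.ofReal_ne_top]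
        exact ENNReal.add_lt_top.2 ⟨ENNReal.mul_lt_top ENNReal.ofReal_lt_top (measure_lt_top _ _),
          ENNReal.mul_lt_top ENNReal.ofReal_lt_top ih⟩
  obtain ⟨n, hn'⟩ := pow_unbounded_of_one_lt (a / l) (one_lt_two : (1:ℝ) < 2)
  refine lt_of_le_of_lt (lintegral_mono fun ω => ENNReal.ofReal_le_ofReal ?_) (hn n)
  refine hm (mem_Ici.2 (by positivity)) (mem_Ici.2 (by positivity)) ?_
  gcongr
  rw [div_lt_iff₀ hl] at hn'
  rw [div_le_iff₀ (by positivity)]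
  linarith

theorem aux_zero_cont (h0 : Θ 0 = 0) (hm : MonotoneOn Θ (Ici 0)) (hc : ConvexOn ℝ (Ici 0) Θ)
    {u : ℕ → ℝ} (hu0 : ∀ n, 0 ≤ u n) (hu : Tendsto u atTop (𝓝 0)) :
    Tendsto (fun n => Θ (u n)) atTop (𝓝 0) := by
  have hu' : Tendsto (fun n => u n * Θ 1) atTop (𝓝 0) := by simpa using hu.mul_const (Θ 1)
  refine squeeze_zero' (Eventually.of_forall fun n => aux_nonneg h0 hm (hu0 n)) ?_ hu'
  filter_upwards [hu.eventually (ge_mem_nhds one_pos)] with n hn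
  simpa using aux_scale h0 hc zero_le_one (hu0 n) hn

theorem aux_lux_tendsto [IsProbabilityMeasure μ] (h0 : Θ 0 = 0) (hm : MonotoneOn Θ (Ici 0))
    (hc : ConvexOn ℝ (Ici 0) Θ)
    (hΔ : ∃ y : ℝ, 0 < y ∧ ∃ k : ℝ, 0 < k ∧ ∀ x : ℝ, y ≤ x → Θ (2 * x) < k * Θ x)
    {Z : ℕ → Ω → ℝ} {S : Ω → ℝ} (hZ : ∀ n, Measurable (Z n)) (hS : MemOrlicz μ Θ S)
    (hZS : ∀ n, ∀ᵐ ω ∂μ, |Z n ω| ≤ |S ω|)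
    (hlim : ∀ᵐ ω ∂μ, Tendsto (fun n => Z n ω) atTop (𝓝 0)) :
    Tendsto (fun n => luxNorm μ Θ (Z n)) atTop (𝓝 0) := by
  have hl : ∀ l : ℝ, 0 < l →
      Tendsto (fun n => ∫⁻ ω, ENNReal.ofReal (Θ (|Z n ω| / l)) ∂μ) atTop (𝓝 0) := by
    intro l hl
    have := tendsto_lintegral_of_dominated_convergence (μ := μ)
      (F := fun n ω => ENNReal.ofReal (Θ (|Z n ω| / l))) (f := fun _ => 0)
      (fun ω => ENNReal.ofReal (Θ (|S ω| / l))) (fun n => aux_meas hm (hZ n) hl)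
      (fun n => by
        filter_upwards [hZS n] with ω hω
        refine ENNReal.ofReal_le_ofReal
          (hm (mem_Ici.2 (by positivity)) (mem_Ici.2 (by positivity)) (by gcongr)))
      (aux_all_finite h0 hm hΔ hS hl).ne
      (by
        filter_upwards [hlim] with ω hω
        have h2 : Tendsto (fun n => |Z n ω| / l) atTop (𝓝 0) := by
          simpa using hω.abs.div_const l
        have h3 := aux_zero_cont h0 hm hc (fun n => by positivity) h2
        simpa using ENNReal.tendsto_ofReal h3)
    simpa using this
  rw [Metric.tendsto_atTop]
  intro ε hε
  have := (hl (ε / 2) (by positivity)).eventually (ge_mem_nhds one_pos)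
  obtain ⟨N, hN⟩ := eventually_atTop.1 this
  refine ⟨N, fun n hn => ?_⟩
  rw [Real.dist_eq, sub_zero, abs_of_nonneg (aux_lux_nonneg _)]
  have : luxNorm μ Θ (Z n) ≤ ε / 2 := csInf_le (aux_bdd _) ⟨by positivity, hN n hn⟩
  linarith

theorem aux_iii_ii [IsProbabilityMeasure μ] (h0 : Θ 0 = 0) (hm : MonotoneOn Θ (Ici 0))
    (hc : ConvexOn ℝ (Ici 0) Θ) (h1 : 1 < Θ 1)
    (hΔ : ∃ y : ℝ, 0 < y ∧ ∃ k : ℝ, 0 < k ∧ ∀ x : ℝ, y ≤ x → Θ (2 * x) < k * Θ x)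
    (Xn : ℕ → Ω → ℝ) (X S : Ω → ℝ) (hXn : ∀ n, MemOrlicz μ Θ (Xn n)) (hX : MemOrlicz μ Θ X)
    (hS : MemOrlicz μ Θ S) (hdom : ∀ n, ∀ᵐ ω ∂μ, |Xn n ω| ≤ S ω)
    (hlim : ∀ᵐ ω ∂μ, Tendsto (fun n => Xn n ω) atTop (𝓝 (X ω))) :
    Tendsto (fun n => ⨅ m : ℝ, (m + luxNorm μ Θ (fun ω => max (Xn n ω - m) 0))) atTop
      (𝓝 (⨅ m : ℝ, (m + luxNorm μ Θ (fun ω => max (X ω - m) 0)))) := by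
  have hT : MemOrlicz μ Θ (fun ω => |S ω| + |X ω|) :=
    aux_mem_add h0 hm hS hX (hS.1.abs.add hX.1.abs) fun ω => by
      rw [abs_of_nonneg (by positivity)]
  have hN := aux_lux_tendsto (μ := μ) h0 hm hc hΔ (Z := fun n ω => |Xn n ω - X ω|)
    (S := fun ω => |S ω| + |X ω|) (fun n => ((hXn n).1.sub hX.1).abs) hT
    (fun n => by
      filter_upwards [hdom n] with ω hω
      rw [abs_abs, abs_of_nonneg (by positivity : 0 ≤ |S ω| + |X ω|)]
      linarith [abs_sub (Xn n ω) (X ω), le_abs_self (S ω)])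
    (by
      filter_upwards [hlim] with ω hω
      simpa using (hω.sub_const (X ω)).abs)
  rw [tendsto_iff_dist_tendsto_zero]
  refine squeeze_zero (fun _ => dist_nonneg) (fun n => ?_) hN
  rw [Real.dist_eq, abs_le]
  have a := aux_pi_lip h0 hm hc h1 (hXn n) hX
  have b := aux_pi_lip h0 hm hc h1 hX (hXn n)
  have e : (fun ω => |X ω - Xn n ω|) = (fun ω => |Xn n ω - X ω|) := by
    funext ω; exact abs_sub_comm _ _
  rw [e] at b
  constructor <;> linarith

/-- If `Δ₂` fails there is a nonnegative `X` with `E Θ(X) < ∞` and `E Θ(2X) = ∞`. -/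
theorem aux_exists_bad [IsProbabilityMeasure μ]
    (hNA : ∀ A : Set Ω, MeasurableSet A → 0 < μ A →
      ∃ B : Set Ω, B ⊆ A ∧ MeasurableSet B ∧ 0 < μ B ∧ μ B < μ A)
    (h0 : Θ 0 = 0) (hm : MonotoneOn Θ (Ici 0)) (h1 : 1 < Θ 1)
    (hΔ : ¬ ∃ y : ℝ, 0 < y ∧ ∃ k : ℝ, 0 < k ∧ ∀ x : ℝ, y ≤ x → Θ (2 * x) < k * Θ x) :
    ∃ X : Ω → ℝ, Measurable X ∧ (∀ ω, 0 ≤ X ω) ∧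
      ∫⁻ ω, ENNReal.ofReal (Θ (X ω)) ∂μ < ⊤ ∧ ∫⁻ ω, ENNReal.ofReal (Θ (2 * X ω)) ∂μ = ⊤ := by
  push Not at hΔ
  have hx : ∀ n : ℕ, ∃ x : ℝ, 1 ≤ x ∧ 4 ^ n * Θ x ≤ Θ (2 * x) := fun n =>
    hΔ 1 one_pos (4 ^ n) (by positivity)
  choose x hx1 hx2 using hx
  have hΘ1 : ∀ n, 1 ≤ Θ (x n) := fun n => h1.le.trans
    (hm (mem_Ici.2 zero_le_one) (mem_Ici.2 (zero_le_one.trans (hx1 n))) (hx1 n))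
  have hΘ0 : ∀ n, 0 < Θ (x n) := fun n => zero_lt_one.trans_le (hΘ1 n)
  have hA : ∀ n : ℕ, ∃ B : Set Ω, MeasurableSet B ∧ μ.real B = (1 / 2) ^ n / Θ (x n) := fun n =>
    aux_sierpinski μ hNA _ (by have := hΘ0 n; positivity) (by
      rw [div_le_one (hΘ0 n)]
      exact (pow_le_one₀ (by norm_num) (by norm_num)).trans (hΘ1 n))
  choose A hAm hAp using hA
  have hμA : ∀ n, μ (A n) = ENNReal.ofReal ((1 / 2) ^ n / Θ (x n)) := fun n => by
    rw [← hAp n, ofReal_measureReal]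
  -- the majorant
  have hsum : ∫⁻ ω, ∑' n, (A n).indicator (fun _ => ENNReal.ofReal (Θ (x n))) ω ∂μ < ⊤ := by
    rw [lintegral_tsum fun n => (measurable_const.indicator (hAm n)).aemeasurable]
    have : ∀ n, ∫⁻ ω, (A n).indicator (fun _ => ENNReal.ofReal (Θ (x n))) ω ∂μ =
        ENNReal.ofReal ((1 / 2) ^ n) := fun n => by
      rw [lintegral_indicator_const (hAm n), hμA, ← ENNReal.ofReal_mul (hΘ0 n).le]
      congr 1
      field_simp [(hΘ0 n).ne']
    simp_rw [this]
    rw [← ENNReal.ofReal_tsum_of_nonneg (fun n => by positivity) summable_geometric_two]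
    exact ENNReal.ofReal_lt_top
  have hmeasW : Measurable fun ω => ∑' n, (A n).indicator (fun _ => ENNReal.ofReal (Θ (x n))) ω :=
    Measurable.tsum fun n => measurable_const.indicator (hAm n)
  set X : Ω → ℝ := fun ω => ⨆ n, (A n).indicator (fun _ => x n) ω with hXdef
  have hXm : Measurable X := Measurable.iSup fun n => measurable_const.indicator (hAm n)
  have hind0 : ∀ n ω, 0 ≤ (A n).indicator (fun _ => x n) ω := fun n ω =>
    indicator_nonneg (fun _ _ => zero_le_one.trans (hx1 n)) _
  have hX0 : ∀ ω, 0 ≤ X ω := fun ω => Real.iSup_nonneg fun n => hind0 n ω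
  -- where the majorant is finite, only finitely many sets contain `ω`
  have hfin : ∀ ω, (∑' n, (A n).indicator (fun _ => ENNReal.ofReal (Θ (x n))) ω) < ⊤ →
      {n | ω ∈ A n}.Finite := by
    intro ω hω
    refine (ENNReal.finite_const_le_of_tsum_ne_top hω.ne one_ne_zero).subset fun n hn => ?_
    simp only [mem_ofPred_eq] at hn ⊢
    rw [indicator_of_mem hn]
    exact ENNReal.one_le_ofReal.2 (hΘ1 n)
  have hfr : ∀ ω, {n | ω ∈ A n}.Finite → (range fun n => (A n).indicator (fun _ => x n) ω).Finite := by
    intro ω hω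
    refine ((hω.image x).insert 0).subset ?_
    rintro _ ⟨n, rfl⟩
    by_cases hn : ω ∈ A n
    · right; exact ⟨n, hn, by simp [hn]⟩
    · left; simp [hn]
  refine ⟨X, hXm, hX0, lt_of_le_of_lt (lintegral_mono fun ω => ?_) hsum, ?_⟩
  · by_cases hω : (∑' n, (A n).indicator (fun _ => ENNReal.ofReal (Θ (x n))) ω) < ⊤
    · obtain ⟨n, hn⟩ : X ω ∈ range fun n => (A n).indicator (fun _ => x n) ω :=
        (range_nonempty _).csSup_mem (hfr ω (hfin ω hω))
      refine le_trans ?_ (ENNReal.le_tsum n)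
      rw [← hn]
      by_cases hn : ω ∈ A n
      · simp [hn]
      · simp [hn, h0]
    · rw [not_lt, top_le_iff] at hω
      rw [hω]; exact le_top
  · have hlow : ∀ n : ℕ, ENNReal.ofReal (2 ^ n) ≤ ∫⁻ ω, ENNReal.ofReal (Θ (2 * X ω)) ∂μ := by
      intro n
      calc ENNReal.ofReal (2 ^ n) ≤ ENNReal.ofReal (Θ (2 * x n)) * μ (A n) := by
            rw [hμA, ← ENNReal.ofReal_mul (by have := hx2 n; have := hΘ0 n; exact le_trans (by positivity) (hx2 n))]
            refine ENNReal.ofReal_le_ofReal ?_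
            have e : (2:ℝ) ^ n = (4 ^ n * Θ (x n)) * ((1 / 2) ^ n / Θ (x n)) := by
              have : (2:ℝ) ^ n = 4 ^ n * (1 / 2) ^ n := by rw [← mul_pow]; norm_num
              have h := (hΘ0 n).ne'
              rw [this]; field_simp
            rw [e]
            have := hΘ0 n
            gcongr
            exact hx2 n
        _ = ∫⁻ ω, (A n).indicator (fun _ => ENNReal.ofReal (Θ (2 * x n))) ω ∂μ :=
            (lintegral_indicator_const (hAm n) _).symm
        _ ≤ _ := by
            refine lintegral_mono_ae ?_
            filter_upwards [ae_lt_top hmeasW hsum.ne] with ω hω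
            by_cases hn : ω ∈ A n
            · rw [indicator_of_mem hn]
              refine ENNReal.ofReal_le_ofReal (hm (mem_Ici.2 ?_) (mem_Ici.2 ?_) ?_)
              · linarith [hx1 n]
              · linarith [hX0 ω]
              · have := le_ciSup (hfr ω (hfin ω hω)).bddAbove n
                rw [indicator_of_mem hn] at this
                have h' : x n ≤ X ω := this
                linarith
            · simp [hn]
    by_contra hne
    obtain ⟨n, hn⟩ := pow_unbounded_of_one_lt
      ((∫⁻ ω, ENNReal.ofReal (Θ (2 * X ω)) ∂μ).toReal) (one_lt_two : (1:ℝ) < 2)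
    have := ENNReal.toReal_mono hne (hlow n)
    rw [ENNReal.toReal_ofReal (by positivity)] at this
    linarith

theorem aux_i_iii [IsProbabilityMeasure μ]
    (hNA : ∀ A : Set Ω, MeasurableSet A → 0 < μ A →
      ∃ B : Set Ω, B ⊆ A ∧ MeasurableSet B ∧ 0 < μ B ∧ μ B < μ A)
    (h0 : Θ 0 = 0) (hm : MonotoneOn Θ (Ici 0))
    (hc : ConvexOn ℝ (Ici 0) Θ) (h1 : 1 < Θ 1)
    (H : ∀ (Xn : ℕ → Ω → ℝ) (X : Ω → ℝ), (∀ n, MemOrlicz μ Θ (Xn n)) → MemOrlicz μ Θ X →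
        (∀ᵐ ω ∂μ, Antitone fun n => Xn n ω) →
        (∀ᵐ ω ∂μ, Tendsto (fun n => Xn n ω) atTop (𝓝 (X ω))) →
        Tendsto (fun n => ⨅ m : ℝ, (m + luxNorm μ Θ (fun ω => max (Xn n ω - m) 0))) atTop
          (𝓝 (⨅ m : ℝ, (m + luxNorm μ Θ (fun ω => max (X ω - m) 0))))) :
    ∃ y : ℝ, 0 < y ∧ ∃ k : ℝ, 0 < k ∧ ∀ x : ℝ, y ≤ x → Θ (2 * x) < k * Θ x := by
  by_contra hΔ
  obtain ⟨X, hXm, hX0, hXfin, hXtop⟩ := aux_exists_bad hNA h0 hm h1 hΔ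
  obtain ⟨r, hr, hr1⟩ := aux_r hc h1
  have hX : MemOrlicz μ Θ X := ⟨hXm, 1, one_pos, by
    simpa [abs_of_nonneg (hX0 _)] using hXfin⟩
  have hXn : ∀ n : ℕ, MemOrlicz μ Θ (fun ω => max (X ω - (n : ℝ)) 0) := fun n =>
    aux_mem_pos h0 hm hX n
  have hz : MemOrlicz μ Θ (fun _ : Ω => (0:ℝ)) := aux_mem_const 0
  have hT := H (fun n ω => max (X ω - (n : ℝ)) 0) (fun _ => 0) hXn hz
    (Eventually.of_forall fun ω => by
      intro a b hab
      have : (a : ℝ) ≤ b := by exact_mod_cast hab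
      exact max_le_max_right _ (by linarith))
    (Eventually.of_forall fun ω => by
      refine tendsto_const_nhds.congr' ?_
      filter_upwards [eventually_ge_atTop ⌈X ω⌉₊] with n hn
      have : X ω ≤ n := Nat.ceil_le.1 hn
      rw [max_eq_right (by linarith)])
  have hzero : (⨅ m : ℝ, (m + luxNorm μ Θ (fun ω => max ((fun _ : Ω => (0:ℝ)) ω - m) 0))) ≤ 0 := by
    refine (ciInf_le (aux_pi_bdd h0 hm hc h1 hz) 0).trans ?_
    simp only [sub_zero, max_self, zero_add]
    refine le_of_forall_pos_le_add fun ε hε => ?_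
    refine csInf_le (aux_bdd _) ⟨by simpa using hε, ?_⟩
    simp [h0]
  have hlow : ∀ n : ℕ, min (1 / 8) ((r - 1) / 8) ≤
      ⨅ m : ℝ, (m + luxNorm μ Θ (fun ω => max ((fun ω => max (X ω - (n : ℝ)) 0) ω - m) 0)) := by
    intro n
    refine le_ciInf fun m => ?_
    have hY := aux_mem_pos h0 hm (hXn n) m
    rcases le_total (-(1 / 8)) m with h | h
    · refine (min_le_left _ _).trans ?_
      have : 1 / 4 ≤ luxNorm μ Θ (fun ω => max ((fun ω => max (X ω - (n : ℝ)) 0) ω - m) 0) := by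
        refine le_csInf (aux_nonempty h0 hm hc hY) ?_
        rintro l ⟨hl, hl'⟩
        by_contra! hlt
        have : ∫⁻ ω, ENNReal.ofReal (Θ (2 * X ω)) ∂μ < ⊤ := by
          refine lt_of_le_of_lt (b := ∫⁻ ω, (ENNReal.ofReal (Θ (4 * (n + |m|))) +
            ENNReal.ofReal (Θ (|max (max (X ω - (n : ℝ)) 0 - m) 0| / l))) ∂μ) ?_ ?_
          · refine lintegral_mono fun ω => ?_
            have hx := hX0 ω
            rcases le_total (X ω) (2 * (n + |m|)) with h' | h'
            · refine le_trans (ENNReal.ofReal_le_ofReal ?_) le_self_add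
              exact hm (mem_Ici.2 (by positivity)) (mem_Ici.2 (by positivity)) (by linarith)
            · refine le_trans (ENNReal.ofReal_le_ofReal ?_) le_add_self
              refine hm (mem_Ici.2 (by positivity)) (mem_Ici.2 (by positivity)) ?_
              rw [le_div_iff₀ hl, abs_of_nonneg (le_max_right _ _)]
              have b1 := le_max_left (max (X ω - (n : ℝ)) 0 - m) 0
              have b2 := le_max_left (X ω - (n : ℝ)) 0
              have b3 := le_abs_self m
              nlinarith
          · rw [lintegral_add_left measurable_const, lintegral_const]
            exact ENNReal.add_lt_top.2
              ⟨ENNReal.mul_lt_top ENNReal.ofReal_lt_top (measure_lt_top _ _),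
                lt_of_le_of_lt hl' ENNReal.one_lt_top⟩
        exact this.ne hXtop
      linarith
    · refine (min_le_right _ _).trans ?_
      have := aux_lux_lower h0 hm hc hr hr1 hY (c := -m) fun ω => by
        have b1 := le_max_left ((fun ω => max (X ω - (n : ℝ)) 0) ω - m) 0
        have b2 := le_max_right (X ω - (n : ℝ)) 0
        dsimp only at b1 ⊢
        linarith
      nlinarith
  have hge := ge_of_tendsto' hT hlow
  have hpos : 0 < min (1 / 8 : ℝ) ((r - 1) / 8) := lt_min (by norm_num) (by linarith)
  linarith

theorem aux_mem_iff {Φ : ℝ → ℝ} {b : ℝ} (hb : 0 < b) (X : Ω → ℝ) :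
    MemOrlicz μ (fun x => Φ x / b) X ↔ MemOrlicz μ Φ X := by
  have e : ∀ l, ∫⁻ ω, ENNReal.ofReal (Φ (|X ω| / l) / b) ∂μ =
      ENNReal.ofReal b⁻¹ * ∫⁻ ω, ENNReal.ofReal (Φ (|X ω| / l)) ∂μ := fun l => by
    rw [← lintegral_const_mul' _ _ ENNReal.ofReal_ne_top]
    refine lintegral_congr fun ω => ?_
    rw [← ENNReal.ofReal_mul (by positivity), div_eq_inv_mul]
  have hb' : ENNReal.ofReal b⁻¹ ≠ 0 := by simpa using hb
  unfold MemOrlicz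
  simp only [e]
  refine and_congr_right fun _ => exists_congr fun l => and_congr_right fun _ => ?_
  constructor
  · intro h
    by_contra h2
    rw [not_lt, top_le_iff] at h2
    rw [h2, ENNReal.mul_top hb'] at h
    exact lt_irrefl _ h
  · exact fun h => ENNReal.mul_lt_top ENNReal.ofReal_lt_top h

end helpers

/-- The following are equivalent: (i) `π_α` is continuous from above; (ii) `π_α` satisfies
the Lebesgue property; (iii) `Φ` satisfies the `Δ₂` condition. -/
theorem stmt_10 {Ω : Type*} [MeasurableSpace Ω] (μ : Measure Ω) [IsProbabilityMeasure μ]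
    (hNA : ∀ A : Set Ω, MeasurableSet A → 0 < μ A →
      ∃ B : Set Ω, B ⊆ A ∧ MeasurableSet B ∧ 0 < μ B ∧ μ B < μ A)
    (Φ : ℝ → ℝ) (hΦ0 : Φ 0 = 0) (hΦ1 : Φ 1 = 1)
    (hΦmono : MonotoneOn Φ (Ici 0)) (hΦconv : ConvexOn ℝ (Ici 0) Φ)
    (α : ℝ) (hα : α ∈ Ioo (0 : ℝ) 1) :
    -- (i) continuity from above ↔ (ii) Lebesgue property
    ((∀ (Xn : ℕ → Ω → ℝ) (X : Ω → ℝ), (∀ n, MemOrlicz μ Φ (Xn n)) → MemOrlicz μ Φ X →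
        (∀ᵐ ω ∂μ, Antitone fun n => Xn n ω) →
        (∀ᵐ ω ∂μ, Tendsto (fun n => Xn n ω) atTop (𝓝 (X ω))) →
        Tendsto (fun n => piHG μ Φ α (Xn n)) atTop (𝓝 (piHG μ Φ α X))) ↔
      (∀ (Xn : ℕ → Ω → ℝ) (X S : Ω → ℝ), (∀ n, MemOrlicz μ Φ (Xn n)) → MemOrlicz μ Φ X →
        MemOrlicz μ Φ S → (∀ n, ∀ᵐ ω ∂μ, |Xn n ω| ≤ S ω) →
        (∀ᵐ ω ∂μ, Tendsto (fun n => Xn n ω) atTop (𝓝 (X ω))) →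
        Tendsto (fun n => piHG μ Φ α (Xn n)) atTop (𝓝 (piHG μ Φ α X)))) ∧
    -- (ii) Lebesgue property ↔ (iii) Δ₂ condition
    ((∀ (Xn : ℕ → Ω → ℝ) (X S : Ω → ℝ), (∀ n, MemOrlicz μ Φ (Xn n)) → MemOrlicz μ Φ X →
        MemOrlicz μ Φ S → (∀ n, ∀ᵐ ω ∂μ, |Xn n ω| ≤ S ω) →
        (∀ᵐ ω ∂μ, Tendsto (fun n => Xn n ω) atTop (𝓝 (X ω))) →
        Tendsto (fun n => piHG μ Φ α (Xn n)) atTop (𝓝 (piHG μ Φ α X))) ↔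
      (∃ y : ℝ, 0 < y ∧ ∃ k : ℝ, 0 < k ∧ ∀ x : ℝ, y ≤ x → Φ (2 * x) < k * Φ x)) := by
  have hb : 0 < 1 - α := sub_pos.2 hα.2
  have h0 : (fun x => Φ x / (1 - α)) 0 = 0 := by simp [hΦ0]
  have hm : MonotoneOn (fun x => Φ x / (1 - α)) (Ici 0) := fun a ha b hb' hab =>
    div_le_div_of_nonneg_right (hΦmono ha hb' hab) hb.le
  have hc : ConvexOn ℝ (Ici 0) (fun x => Φ x / (1 - α)) := by
    have := hΦconv.smul (c := (1 - α)⁻¹) (by positivity)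
    refine this.congr fun x _ => ?_
    simp [div_eq_inv_mul]
  have h1 : 1 < (fun x => Φ x / (1 - α)) 1 := by
    simp only [hΦ1]
    rw [lt_div_iff₀ hb]; linarith [hα.1]
  have hmem : ∀ X : Ω → ℝ, MemOrlicz μ Φ X ↔ MemOrlicz μ (fun x => Φ x / (1 - α)) X := fun X =>
    (aux_mem_iff hb X).symm
  have hΔ : (∃ y : ℝ, 0 < y ∧ ∃ k : ℝ, 0 < k ∧ ∀ x : ℝ, y ≤ x → Φ (2 * x) < k * Φ x) ↔
      (∃ y : ℝ, 0 < y ∧ ∃ k : ℝ, 0 < k ∧ ∀ x : ℝ, y ≤ x →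
        (fun x => Φ x / (1 - α)) (2 * x) < k * (fun x => Φ x / (1 - α)) x) := by
    refine exists_congr fun y => and_congr_right fun _ => exists_congr fun k =>
      and_congr_right fun _ => forall_congr' fun x => imp_congr_right fun _ => ?_
    simp only
    rw [← mul_div_assoc, div_lt_div_iff_of_pos_right hb]
  rw [hΔ]
  simp only [hmem]
  unfold piHG
  have i_iii := aux_i_iii (μ := μ) hNA h0 hm hc h1
  have iii_ii := aux_iii_ii (μ := μ) h0 hm hc h1
  refine ⟨⟨fun hi => iii_ii (i_iii hi), fun hii => ?_⟩, ⟨fun hii => i_iii ?_, iii_ii⟩⟩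
  all_goals
    intro Xn X hXn hX hanti hlim
    refine hii Xn X (fun ω => |Xn 0 ω| + |X ω|) hXn hX
      (aux_mem_add h0 hm (hXn 0) hX ((hXn 0).1.abs.add hX.1.abs) fun ω => by
        rw [abs_of_nonneg (by positivity)]) (fun n => ?_) hlim
    filter_upwards [hanti, hlim] with ω ha hl
    have u1 : Xn n ω ≤ Xn 0 ω := ha (Nat.zero_le n)
    have u2 : X ω ≤ Xn n ω := ha.le_of_tendsto hl n
    rw [abs_le]
    constructor <;> linarith [neg_abs_le (X ω), le_abs_self (Xn 0 ω), abs_nonneg (Xn 0 ω),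
      abs_nonneg (X ω)]
end

section
/- The Haezendonck–Goovaerts premium principle π_α, restricted to the Young class Y^Φ, is lower semicontinuous with respect to Φ-convergence in distribution: for every sequence (X_n) ⊂ Y^Φ and every X ∈ Y^Φ, if X_n → X in distribution and E[Φ(|X_n|)] → E[Φ(|X|)], then π_α(X) ≤ liminf_n π_α(X_n). -/
open MeasureTheory Filter Set Topology

/-- Membership in the Young class `Y^Φ`. -/
def MemYoung {Ω : Type*} [MeasurableSpace Ω] (μ : Measure Ω)
    (Φ : ℝ → ℝ) (X : Ω → ℝ) : Prop :=
  Measurable X ∧ ∫⁻ ω, ENNReal.ofReal (Φ |X ω|) ∂μ < ⊤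


/-- modular condition -/
def HGMod {Ω : Type*} [MeasurableSpace Ω] (μ : Measure Ω) (T : ℝ → ℝ) (X : Ω → ℝ) (m l : ℝ) : Prop :=
  ∫⁻ ω, ENNReal.ofReal (T ((X ω - m) / l)) ∂μ ≤ 1

lemma HGMod.mono {Ω : Type*} [MeasurableSpace Ω] {μ : Measure Ω} {T : ℝ → ℝ} (hT : Monotone T)
    (hT0 : ∀ x ≤ 0, T x = 0) {X : Ω → ℝ} {m l m' l' : ℝ} (hm : m ≤ m') (hl0 : 0 < l) (hl : l ≤ l')
    (h : HGMod μ T X m l) : HGMod μ T X m' l' := by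
  refine le_trans (lintegral_mono fun ω => ENNReal.ofReal_le_ofReal ?_) h
  by_cases hx : X ω - m' ≤ 0
  · rw [hT0 _ (div_nonpos_of_nonpos_of_nonneg hx (by linarith))]
    have := hT (min_le_right 0 ((X ω - m) / l))
    rwa [hT0 _ (min_le_left _ _)] at this
  · push Not at hx
    exact hT (div_le_div₀ (by linarith) (by linarith) hl0 hl)

lemma HGMod.exists {Ω : Type*} [MeasurableSpace Ω] {μ : Measure Ω} [IsProbabilityMeasure μ]
    {T : ℝ → ℝ} (hT : Monotone T)
    (hT0 : ∀ x ≤ 0, T x = 0) (hc : ConvexOn ℝ univ T) (hcont : Continuous T) {X : Ω → ℝ}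
    (hXm : Measurable X)
    (hX : ∫⁻ ω, ENNReal.ofReal (T |X ω|) ∂μ < ⊤) (m : ℝ) : ∃ l, 0 < l ∧ HGMod μ T X m l := by
  have hnn : ∀ x, 0 ≤ T x := fun x => by
    have := hT (min_le_right 0 x)
    rwa [hT0 _ (min_le_left _ _)] at this
  have hscale : ∀ x k : ℝ, 1 ≤ k → T (x / k) ≤ T x / k := by
    intro x k hk
    have h1 : (0:ℝ) ≤ 1 / k := by positivity
    have h2 : (0:ℝ) ≤ 1 - 1 / k := by
      have : 1 / k ≤ 1 := by rw [div_le_one (by linarith)]; exact hk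
      linarith
    have := hc.2 (mem_univ x) (mem_univ 0) h1 h2 (by ring)
    simp only [smul_eq_mul, hT0 0 le_rfl, mul_zero, add_zero] at this
    rw [show x / k = 1 / k * x by ring, show T x / k = 1 / k * T x by ring]
    exact this
  have hTint : Integrable (fun ω => T |X ω|) μ := by
    refine ⟨(hcont.measurable.comp hXm.abs).aestronglyMeasurable, ?_⟩
    rw [hasFiniteIntegral_iff_ofReal (ae_of_all _ fun ω => hnn _)]
    exact hX
  set C := ∫ ω, T |X ω| ∂μ
  have hC : 0 ≤ C := integral_nonneg fun ω => hnn _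
  set k := 1 + C + T |m|
  have hk : 1 ≤ k := by have := hnn |m|; simp only [k]; linarith
  refine ⟨2 * k, by linarith, ?_⟩
  have hTint2 : Integrable (fun ω => (T |X ω| + T |m|) / (2 * k)) μ :=
    (hTint.add (integrable_const _)).div_const _
  have key : ∀ ω, T ((X ω - m) / (2 * k)) ≤ (T |X ω| + T |m|) / (2 * k) := by
    intro ω
    have h1 : (X ω - m) / (2 * k) ≤ (1/2) * (|X ω| / k) + (1/2) * (|m| / k) := by
      rw [show (1/2) * (|X ω| / k) + (1/2) * (|m| / k) = (|X ω| + |m|) / (2 * k) by field_simp]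
      gcongr
      have := le_abs_self (X ω); have := neg_abs_le m; linarith
    have h2 := hc.2 (mem_univ (|X ω| / k)) (mem_univ (|m| / k)) 
      (show (0:ℝ) ≤ 1/2 by norm_num) (show (0:ℝ) ≤ 1/2 by norm_num) (by norm_num)
    simp only [smul_eq_mul] at h2
    have h3 := hscale |X ω| k hk
    have h4 := hscale |m| k hk
    have h5 : (T |X ω| + T |m|) / (2 * k) = 1/2 * (T |X ω| / k) + 1/2 * (T |m| / k) := by
      field_simp
    rw [h5]
    linarith [hT h1]
  refine le_trans (lintegral_mono fun ω => ENNReal.ofReal_le_ofReal (key ω)) ?_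
  rw [← ofReal_integral_eq_lintegral_ofReal hTint2
    (ae_of_all _ fun ω => by have := hnn |X ω|; have := hnn |m|; positivity),
    ← ENNReal.ofReal_one]
  apply ENNReal.ofReal_le_ofReal
  rw [integral_div, integral_add hTint (integrable_const _), integral_const]
  simp only [probReal_univ, smul_eq_mul, one_mul]
  rw [div_le_one (by linarith)]
  have := hnn |m|
  change C + T |m| ≤ 2 * (1 + C + T |m|)
  linarith

lemma HGMod.integral_le {Ω : Type*} [MeasurableSpace Ω] {μ : Measure Ω}
    {T : ℝ → ℝ} {X : Ω → ℝ} {m l : ℝ} (h : HGMod μ T X m l)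
    {g : Ω → ℝ} (hg : Integrable g μ) (hg0 : ∀ ω, 0 ≤ g ω)
    (hle : ∀ ω, g ω ≤ T ((X ω - m) / l)) : ∫ ω, g ω ∂μ ≤ 1 := by
  have h1 : ENNReal.ofReal (∫ ω, g ω ∂μ) ≤ 1 := by
    rw [ofReal_integral_eq_lintegral_ofReal hg (ae_of_all _ hg0)]
    exact (lintegral_mono fun ω => ENNReal.ofReal_le_ofReal (hle ω)).trans h
  rwa [ENNReal.ofReal_le_one] at h1

/-- cutoff -/
noncomputable def hgCut (K : ℝ) : BoundedContinuousFunction ℝ ℝ :=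
  BoundedContinuousFunction.ofNormedAddCommGroup (fun x => max 0 (min 1 (x + K)))
    (by fun_prop) 1 (fun x => by
      rw [Real.norm_eq_abs, abs_of_nonneg (le_max_left _ _)]
      exact max_le zero_le_one (min_le_left _ _))

lemma hgCut_apply (K x : ℝ) : hgCut K x = max 0 (min 1 (x + K)) := rfl

lemma HGMod.bound {Ω : Type*} [MeasurableSpace Ω] {μ : Measure Ω} [IsProbabilityMeasure μ]
    {T : ℝ → ℝ} (hT : Monotone T) (hT0 : ∀ x ≤ 0, T x = 0) {X : Ω → ℝ} (hX : Measurable X)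
    {m l K t a : ℝ} (hl : 0 < l) (h : HGMod μ T X m l) (hat : 1 < a * T t)
    (ha : a ≤ ∫ ω, hgCut K (X ω) ∂μ) : -K - m ≤ t * l := by
  have hnn : ∀ x, 0 ≤ T x := fun x => by
    have := hT (min_le_right 0 x)
    rwa [hT0 _ (min_le_left _ _)] at this
  by_contra! hcon
  have hlt : t ≤ (-K - m) / l := by rw [le_div_iff₀ hl]; exact hcon.le
  have hi : Integrable (fun ω => hgCut K (X ω)) μ := by
    refine Integrable.of_bound ((hgCut K).continuous.measurable.comp hX).aestronglyMeasurable 1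
      (ae_of_all _ fun ω => ?_)
    rw [hgCut_apply, Real.norm_eq_abs, abs_of_nonneg (le_max_left _ _)]
    exact max_le zero_le_one (min_le_left _ _)
  have := h.integral_le (hi.mul_const (T t))
    (fun ω => mul_nonneg (by rw [hgCut_apply]; exact le_max_left _ _) (hnn _)) (by
      intro ω
      by_cases hx : X ω + K ≤ 0
      · have : hgCut K (X ω) = 0 := by
          rw [hgCut_apply]; exact max_eq_left ((min_le_right _ _).trans hx)
        rw [this, zero_mul]; exact hnn _
      · push Not at hx
        have h1 : hgCut K (X ω) ≤ 1 := by
          rw [hgCut_apply]; exact max_le zero_le_one (min_le_left _ _)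
        have h2 : T t ≤ T ((X ω - m) / l) :=
          hT (hlt.trans (by gcongr; linarith))
        nlinarith [hnn t])
  rw [integral_mul_const] at this
  nlinarith [hnn t]

lemma hgCut_exists {Ω : Type*} [MeasurableSpace Ω] {μ : Measure Ω} [IsProbabilityMeasure μ]
    {X : Ω → ℝ} (hX : Measurable X) {a : ℝ} (ha : a < 1) :
    ∃ K, a < ∫ ω, hgCut K (X ω) ∂μ := by
  have : Tendsto (fun n : ℕ => ∫ ω, hgCut n (X ω) ∂μ) atTop (𝓝 (∫ _, (1:ℝ) ∂μ)) := by
    refine tendsto_integral_of_dominated_convergence (fun _ => 1)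
      (fun n => ((hgCut n).continuous.measurable.comp hX).aestronglyMeasurable)
      (integrable_const _) (fun n => ae_of_all _ fun ω => ?_) (ae_of_all _ fun ω => ?_)
    · rw [hgCut_apply, Real.norm_eq_abs, abs_of_nonneg (le_max_left _ _)]
      exact max_le zero_le_one (min_le_left _ _)
    · refine tendsto_const_nhds.congr' ?_
      obtain ⟨N, hN⟩ := exists_nat_ge (1 - X ω)
      filter_upwards [eventually_ge_atTop N] with n hn
      have : (N:ℝ) ≤ n := by exact_mod_cast hn
      rw [hgCut_apply, min_eq_left (by linarith), max_eq_right zero_le_one]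
  simp only [integral_const, probReal_univ, smul_eq_mul, mul_one] at this
  obtain ⟨n, hn⟩ := (this.eventually (lt_mem_nhds ha)).exists
  exact ⟨n, hn⟩

lemma HGMod.fatou {Ω : Type*} [MeasurableSpace Ω] {μ : Measure Ω} [IsProbabilityMeasure μ]
    {T : ℝ → ℝ} (hnn : ∀ x, 0 ≤ T x) (hcont : Continuous T) {Xn : ℕ → Ω → ℝ} {X : Ω → ℝ}
    (hXn : ∀ n, Measurable (Xn n)) (hX : Measurable X)
    (hdist : ∀ f : BoundedContinuousFunction ℝ ℝ,
      Tendsto (fun n => ∫ ω, f (Xn n ω) ∂μ) atTop (𝓝 (∫ ω, f (X ω) ∂μ)))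
    {m l : ℝ} (h : ∀ᶠ n in atTop, HGMod μ T (Xn n) m l) : HGMod μ T X m l := by
  have hcM : ∀ M : ℕ, Continuous (fun x : ℝ => min (T ((x - m) / l)) M) := fun M => by fun_prop
  have hbM : ∀ M : ℕ, ∀ x : ℝ, ‖min (T ((x - m) / l)) (M:ℝ)‖ ≤ M := fun M x => by
    rw [Real.norm_eq_abs, abs_of_nonneg (le_min (hnn _) (Nat.cast_nonneg _))]
    exact min_le_right _ _
  have hiM : ∀ (M : ℕ) (Y : Ω → ℝ), Measurable Y →
      Integrable (fun ω => min (T ((Y ω - m) / l)) (M:ℝ)) μ := fun M Y hY =>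
    Integrable.of_bound ((hcM M).measurable.comp hY).aestronglyMeasurable M
      (ae_of_all _ fun ω => hbM M (Y ω))
  have hM : ∀ M : ℕ, ∫⁻ ω, ENNReal.ofReal (min (T ((X ω - m) / l)) M) ∂μ ≤ 1 := by
    intro M
    have h1 := hdist (BoundedContinuousFunction.ofNormedAddCommGroup _ (hcM M) M (hbM M))
    have h2 : ∫ ω, min (T ((X ω - m) / l)) (M:ℝ) ∂μ ≤ 1 := by
      refine le_of_tendsto h1 (h.mono fun n hn => ?_)
      exact hn.integral_le (hiM M _ (hXn n)) (fun ω => le_min (hnn _) (Nat.cast_nonneg _))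
        (fun ω => min_le_left _ _)
    rw [← ofReal_integral_eq_lintegral_ofReal (hiM M X hX)
      (ae_of_all _ fun ω => le_min (hnn _) (Nat.cast_nonneg _))]
    exact ENNReal.ofReal_le_one.2 h2
  have hlim : ∀ ω, Tendsto (fun M : ℕ => ENNReal.ofReal (min (T ((X ω - m) / l)) M)) atTop
      (𝓝 (ENNReal.ofReal (T ((X ω - m) / l)))) := by
    intro ω
    refine tendsto_const_nhds.congr' ?_
    obtain ⟨N, hN⟩ := exists_nat_ge (T ((X ω - m) / l))
    filter_upwards [eventually_ge_atTop N] with n hn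
    have : (N:ℝ) ≤ n := by exact_mod_cast hn
    rw [min_eq_left (by linarith)]
  have := lintegral_tendsto_of_tendsto_of_monotone (μ := μ)
    (fun M => (ENNReal.measurable_ofReal.comp ((hcM M).measurable.comp hX)).aemeasurable)
    (ae_of_all _ fun ω => fun M N hMN => ENNReal.ofReal_le_ofReal
      (min_le_min_left _ (by exact_mod_cast hMN))) (ae_of_all _ hlim)
  exact le_of_tendsto' this hM

/-- `π_α`, restricted to the Young class `Y^Φ`, is lower semicontinuous with respect to
`Φ`-convergence in distribution: if `X_n → X` in distribution (tested against bounded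
continuous functions) and `E[Φ(|X_n|)] → E[Φ(|X|)]`, then `π_α(X) ≤ liminf π_α(X_n)`. -/
theorem stmt_11 {Ω : Type*} [MeasurableSpace Ω] (μ : Measure Ω) [IsProbabilityMeasure μ]
    (hNA : ∀ A : Set Ω, MeasurableSet A → 0 < μ A →
      ∃ B : Set Ω, B ⊆ A ∧ MeasurableSet B ∧ 0 < μ B ∧ μ B < μ A)
    (Φ : ℝ → ℝ) (hΦ0 : Φ 0 = 0) (hΦ1 : Φ 1 = 1)
    (hΦmono : MonotoneOn Φ (Ici 0)) (hΦconv : ConvexOn ℝ (Ici 0) Φ)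
    (α : ℝ) (hα : α ∈ Ioo (0 : ℝ) 1)
    (Xn : ℕ → Ω → ℝ) (X : Ω → ℝ)
    (hXn : ∀ n, MemYoung μ Φ (Xn n)) (hX : MemYoung μ Φ X)
    (hdist : ∀ f : BoundedContinuousFunction ℝ ℝ,
      Tendsto (fun n => ∫ ω, f (Xn n ω) ∂μ) atTop (𝓝 (∫ ω, f (X ω) ∂μ)))
    (hmom : Tendsto (fun n => ∫ ω, Φ |Xn n ω| ∂μ) atTop (𝓝 (∫ ω, Φ |X ω| ∂μ))) :
    ((piHG μ Φ α X : ℝ) : EReal)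
      ≤ Filter.liminf (fun n => ((piHG μ Φ α (Xn n) : ℝ) : EReal)) atTop := by
  obtain ⟨hα0, hα1⟩ := hα
  have h1α : 0 < 1 - α := by linarith
  set T : ℝ → ℝ := fun x => Φ (max x 0) / (1 - α) with hTdef
  have hmono : Monotone T := by
    intro x y hxy
    exact div_le_div_of_nonneg_right (hΦmono (mem_Ici.2 (le_max_right _ _)) (mem_Ici.2 (le_max_right _ _))
      (max_le_max_right _ hxy)) h1α.le
  have hT0 : ∀ x ≤ 0, T x = 0 := fun x hx => by simp [hTdef, max_eq_right hx, hΦ0]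
  have hnn : ∀ x, 0 ≤ T x := fun x => by
    have := hmono (min_le_right 0 x)
    rwa [hT0 _ (min_le_left _ _)] at this
  have hconv : ConvexOn ℝ univ T := by
    refine ⟨convex_univ, fun x _ y _ a b ha hb hab => ?_⟩
    have h1 := hΦconv.2 (le_max_right x 0 : max x 0 ∈ Ici 0) (le_max_right y 0 : max y 0 ∈ Ici 0)
      ha hb hab
    simp only [smul_eq_mul] at h1 ⊢
    have hp : 0 ≤ a * max x 0 + b * max y 0 :=
      add_nonneg (mul_nonneg ha (le_max_right _ _)) (mul_nonneg hb (le_max_right _ _))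
    have h2 : Φ (max (a * x + b * y) 0) ≤ Φ (a * max x 0 + b * max y 0) := by
      refine hΦmono (mem_Ici.2 (le_max_right _ _)) hp (max_le ?_ hp)
      exact add_le_add (mul_le_mul_of_nonneg_left (le_max_left _ _) ha)
        (mul_le_mul_of_nonneg_left (le_max_left _ _) hb)
    calc T (a * x + b * y) ≤ (a * Φ (max x 0) + b * Φ (max y 0)) / (1 - α) :=
          div_le_div_of_nonneg_right (h2.trans h1) h1α.le
      _ = a * T x + b * T y := by simp only [hTdef]; ring
  have hcont : Continuous T := by
    rw [← continuousOn_univ]; exact hconv.continuousOn isOpen_univ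
  have hT1 : 1 < T 1 := by
    simp only [hTdef]
    rw [max_eq_left zero_le_one, hΦ1, lt_div_iff₀ h1α]; linarith
  have hYoung : ∀ Y : Ω → ℝ, MemYoung μ Φ Y → ∫⁻ ω, ENNReal.ofReal (T |Y ω|) ∂μ < ⊤ := by
    intro Y hY
    have : ∀ ω, ENNReal.ofReal (T |Y ω|) = ENNReal.ofReal (1 / (1 - α)) * ENNReal.ofReal (Φ |Y ω|) := by
      intro ω
      rw [← ENNReal.ofReal_mul (by positivity)]
      simp only [hTdef]
      rw [max_eq_left (abs_nonneg _)]; congr 1; ring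
    simp_rw [this]
    rw [lintegral_const_mul' _ _ ENNReal.ofReal_ne_top]
    exact ENNReal.mul_lt_top ENNReal.ofReal_lt_top hY.2
  have hlux : ∀ (Y : Ω → ℝ) (m : ℝ),
      luxNorm μ (fun x => Φ x / (1 - α)) (fun ω => max (Y ω - m) 0)
        = sInf {l | 0 < l ∧ HGMod μ T Y m l} := by
    intro Y m
    unfold luxNorm
    congr 1
    ext l
    simp only [mem_ofPred_eq, HGMod, hTdef]
    refine and_congr_right fun hl => ?_
    have : ∀ ω, |max (Y ω - m) 0| / l = max ((Y ω - m) / l) 0 := by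
      intro ω
      rw [abs_of_nonneg (le_max_right _ _), ← max_div_div_right hl.le, zero_div]
    simp_rw [this]
  -- constants
  obtain ⟨t, ht0, ht1, htT⟩ : ∃ t, 0 < t ∧ t < 1 ∧ 1 < T t := by
    have h1 : ∀ᶠ t in 𝓝[<] (1:ℝ), 1 < T t :=
      (hcont.continuousAt.eventually (lt_mem_nhds hT1)).filter_mono nhdsWithin_le_nhds
    have h2 : ∀ᶠ t in 𝓝[<] (1:ℝ), t ∈ Ioo (0:ℝ) 1 := Ioo_mem_nhdsLT zero_lt_one
    obtain ⟨t, h3, h4⟩ := (h1.and h2).exists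
    exact ⟨t, h4.1, h4.2, h3⟩
  obtain ⟨a, ha1, haT⟩ : ∃ a < 1, 1 < a * T t := by
    obtain ⟨a, h1, h2⟩ := exists_between (inv_lt_one_of_one_lt₀ htT)
    refine ⟨a, h2, ?_⟩
    rwa [inv_lt_iff_one_lt_mul₀ (by linarith)] at h1
  obtain ⟨K, hK⟩ := hgCut_exists (μ := μ) hX.1 ha1
  -- upper bound on piHG X
  have hup : ∀ m l, 0 < l → HGMod μ T X m l → piHG μ Φ α X ≤ m + l := by
    intro m l hl hml
    have hb : BddBelow (range fun m : ℝ =>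
        m + luxNorm μ (fun x => Φ x / (1 - α)) (fun ω => max (X ω - m) 0)) := by
      refine ⟨-K, ?_⟩
      rintro _ ⟨m, rfl⟩
      simp only
      rw [hlux]
      have : -K - m ≤ sInf {l | 0 < l ∧ HGMod μ T X m l} := by
        refine le_csInf (HGMod.exists hmono hT0 hconv hcont hX.1 (hYoung X hX) m) ?_
        rintro l ⟨hl, hml⟩
        have := hml.bound hmono hT0 hX.1 hl haT hK.le
        nlinarith
      linarith
    refine (ciInf_le hb m).trans ?_
    rw [hlux]
    have : sInf {l | 0 < l ∧ HGMod μ T X m l} ≤ l :=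
      csInf_le ⟨0, fun x hx => hx.1.le⟩ ⟨hl, hml⟩
    linarith
  have hlow : ∀ n c, piHG μ Φ α (Xn n) < c → ∃ m l, 0 < l ∧ m + l < c ∧ HGMod μ T (Xn n) m l := by
    intro n c hc
    obtain ⟨m, hm⟩ := exists_lt_of_ciInf_lt hc
    rw [hlux] at hm
    obtain ⟨l, ⟨hl, hml⟩, hlt⟩ := exists_lt_of_csInf_lt
      (HGMod.exists hmono hT0 hconv hcont (hXn n).1 (hYoung _ (hXn n)) m) (lt_sub_iff_add_lt'.2 hm)
    exact ⟨m, l, hl, by linarith, hml⟩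
  by_contra! hcon
  obtain ⟨c, hc1, hc2⟩ := EReal.lt_iff_exists_real_btwn.1 hcon
  have hc2 : c < piHG μ Φ α X := by exact_mod_cast hc2
  have hfr : ∃ᶠ n in atTop, piHG μ Φ α (Xn n) < c := by
    have := frequently_lt_of_liminf_lt (by isBoundedDefault) hc1
    exact this.mono fun n hn => by exact_mod_cast hn
  have hev : ∀ᶠ n in atTop, a < ∫ ω, hgCut K (Xn n ω) ∂μ :=
    (hdist (hgCut K)).eventually (lt_mem_nhds hK)
  obtain ⟨φ, hφ, hφp⟩ := extraction_of_frequently_atTop (hfr.and_eventually hev)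
  choose m l hl hml hmod using fun n => hlow (φ n) c (hφp n).1
  have hmem : ∀ n, m n ∈ Icc (-(t * c + K) / (1 - t)) c := by
    intro n
    have h1 := (hmod n).bound hmono hT0 (hXn _).1 (hl n) haT (hφp n).2.le
    refine ⟨?_, by linarith [hl n, hml n]⟩
    rw [div_le_iff₀ (by linarith)]
    nlinarith [hml n]
  obtain ⟨m0, -, ψ, hψ, hlim⟩ := isCompact_Icc.tendsto_subseq hmem
  set e := (piHG μ Φ α X - c) / 4 with he
  have hepos : 0 < e := by simp only [he]; linarith
  have hclose : ∀ᶠ n in atTop, |m (ψ n) - m0| < e := by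
    have := (Metric.tendsto_nhds.1 hlim) e hepos
    simpa [Real.dist_eq] using this
  have hall : ∀ᶠ n in atTop, HGMod μ T (Xn (φ (ψ n))) (m0 + e) (c - m0 + e) := by
    filter_upwards [hclose] with n hn
    rw [abs_lt] at hn
    exact (hmod (ψ n)).mono hmono hT0 (by linarith) (hl _) (by linarith [hml (ψ n)])
  have hpos : 0 < c - m0 + e := by
    obtain ⟨n, hn⟩ := hclose.exists
    rw [abs_lt] at hn
    linarith [hl (ψ n), hml (ψ n)]
  have hfin := HGMod.fatou hnn hcont (fun n => (hXn (φ (ψ n))).1) hX.1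
    (fun f => (hdist f).comp (hφ.comp hψ).tendsto_atTop) hall
  have := hup _ _ hpos hfin
  linarith
end
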